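/- arXiv:2509.20738 — 2 statements merged into one kernel-verified Lean document; each statement's English description precedes it below -/
import Mathlib

section
/- Let G be a countable discrete infinite amenable group, let π : (X,G) → (Y,G) be a factor map between G-systems, let 𝒰 be a finite Borel cover of X, and let {c^A_S} be a system of coefficients. Then the set function φ on nonempty finite subsets of G defined by φ(F) := Σ_{S⊆F} c^F_S · log N(𝒰_S|Y) is non-negative, monotone (φ(E) ≤ φ(F) whenever E ⊆ F), G-invariant (φ(Fg) = φ(F) for every g ∈ G), and sub-additive (φ(E ∪ F) ≤ φ(E) + φ(F) whenever E ∩ F = ∅); consequently the limit Asc_top(G,𝒰|Y) := lim_{n→∞} (1/|F_n|) Σ_{S⊆F_n} c^{F_n}_S log N(𝒰_S|Y) exists and takes the same value for every Følner sequence {F_n} of G. -/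
open MeasureTheory Filter Set

noncomputable section

namespace AscLocal

/-- Limit of a real sequence (a junk value if the sequence does not converge). -/
def limSeq (f : ℕ → ℝ) : ℝ := limUnder Filter.atTop f

variable {G X Y : Type*}

/-- `U` is a cover of the whole space. -/
def IsCover (U : Finset (Set X)) : Prop := ⋃₀ (U : Set (Set X)) = Set.univ

/-- every member of `α` is contained in some member of `U` (`α ⪰ U`). -/
def Refines (α U : Finset (Set X)) : Prop := ∀ A ∈ α, ∃ B ∈ U, A ⊆ B

/-- `α` is a finite measurable partition of the space. -/
def IsMPartition [MeasurableSpace X] (α : Finset (Set X)) : Prop :=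
  IsCover α ∧ (∀ A ∈ α, MeasurableSet A) ∧
    ∀ A ∈ α, ∀ B ∈ α, A ≠ B → Disjoint A B

/-- Følner sequence of a group. -/
def IsFolner [Group G] [DecidableEq G] (F : ℕ → Finset G) : Prop :=
  (∀ n, (F n).Nonempty) ∧
    ∀ g : G, Tendsto (fun n =>
      ((((((F n).image fun h => g * h) \ F n) ∪ (F n \ ((F n).image fun h => g * h)))).card : ℝ)
        / ((F n).card : ℝ)) atTop (nhds 0)

/-- The join `⋁_{g ∈ S} g⁻¹ U` of the pullbacks of the cover `U` under the action `act`. -/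
def coverDyn [DecidableEq G] (act : G → X → X) (U : Finset (Set X)) (S : Finset G) :
    Finset (Set X) := by
  classical
  exact (S.pi fun _ => U).image fun f => ⋂ g, ⋂ (h : g ∈ S), act g ⁻¹' f g h

/-- The join `⋁_{i ∈ S} T^{-i} U` for a single transformation `T`. -/
def coverIt (T : X → X) (U : Finset (Set X)) (S : Finset ℕ) : Finset (Set X) := by
  classical
  exact (S.pi fun _ => U).image fun f => ⋂ i, ⋂ (h : i ∈ S), (T^[i]) ⁻¹' f i h

/-- join of two finite families of sets. -/
def joinP (α β : Finset (Set X)) : Finset (Set X) := by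
  classical
  exact (α ×ˢ β).image fun p => p.1 ∩ p.2

/-- minimal number of members of `U` needed to cover `K`. -/
def covNum (U : Finset (Set X)) (K : Set X) : ℕ :=
  sInf {n | ∃ V : Finset (Set X), V ⊆ U ∧ V.card = n ∧ K ⊆ ⋃₀ (V : Set (Set X))}

/-- `N(U|Y) = sup_y N(U | pr⁻¹ y)` for a factor map `pr : X → Y`. -/
def covNumRel (pr : X → Y) (U : Finset (Set X)) : ℕ :=
  sSup {n | ∃ y : Y, n = covNum U (pr ⁻¹' {y})}

/-- Shannon entropy of a finite partition. -/
def entPart [MeasurableSpace X] (μ : Measure X) (α : Finset (Set X)) : ℝ :=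
  ∑ A ∈ α, Real.negMulLog (μ A).toReal

/-- entropy of a finite cover: infimum over finer partitions. -/
def entCov [MeasurableSpace X] (μ : Measure X) (U : Finset (Set X)) : ℝ :=
  sInf {h | ∃ α, IsMPartition (X := X) α ∧ Refines α U ∧ h = entPart μ α}

/-- conditional entropy of a partition given the σ-algebra `pr⁻¹ ℬ(Y)`:
`H_μ(α|Y) = ∑_{A ∈ α} ∫ -E(1_A|pr⁻¹ ℬ(Y)) log E(1_A|pr⁻¹ ℬ(Y)) dμ`. -/
def condEntPart [MeasurableSpace X] [MeasurableSpace Y] (μ : Measure X) (pr : X → Y)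
    (α : Finset (Set X)) : ℝ :=
  ∑ A ∈ α, ∫ x, Real.negMulLog
    ((μ[A.indicator (fun _ => (1 : ℝ)) | MeasurableSpace.comap pr ‹_›]) x) ∂μ

/-- conditional entropy of a cover given `pr⁻¹ ℬ(Y)`: infimum over finer partitions. -/
def condEntCover [MeasurableSpace X] [MeasurableSpace Y] (μ : Measure X) (pr : X → Y)
    (U : Finset (Set X)) : ℝ :=
  sInf {h | ∃ α, IsMPartition (X := X) α ∧ Refines α U ∧ h = condEntPart μ pr α}

/-- the coefficient `c^A_S = ∫ x^{|S|} (1-x)^{|A|-|S|} dλ(x)`. -/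
def coeff (lam : Measure ℝ) (A S : Finset G) : ℝ :=
  ∫ x, x ^ S.card * (1 - x) ^ (A.card - S.card) ∂lam

/-- `lam` is a symmetric probability measure on `[0,1]`. -/
def IsCoeffMeasure (lam : Measure ℝ) : Prop :=
  IsProbabilityMeasure lam ∧ lam (Set.Icc (0 : ℝ) 1)ᶜ = 0 ∧
    lam.map (fun x => 1 - x) = lam

/-- the uniform system of coefficients `c^A_S = 2^{-|A|}`. -/
def unifCoeff (A _S : Finset G) : ℝ := (1 / 2) ^ A.card

/-- the finite family `{U 0, …, U (d-1)}` as a `Finset` of sets. -/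
def ofFun {d : ℕ} (U : Fin d → Set X) : Finset (Set X) := by
  classical
  exact Finset.univ.image U

section GroupAsc

variable [Group G] [DecidableEq G]

/-- the sequence `n ↦ (1/|F_n|) ∑_{S ⊆ F_n} c^{F_n}_S H_μ(α_S|Y)`. -/
def ascCondPartSeq [MeasurableSpace X] [MeasurableSpace Y] (μ : Measure X) (pr : X → Y)
    (c : Finset G → Finset G → ℝ) (act : G → X → X) (α : Finset (Set X))
    (F : ℕ → Finset G) (n : ℕ) : ℝ :=
  (1 / ((F n).card : ℝ)) *
    ∑ S ∈ (F n).powerset, c (F n) S * condEntPart μ pr (coverDyn act α S)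

/-- `Asc_μ(G,α|Y)`. -/
def AscCondPart [MeasurableSpace X] [MeasurableSpace Y] (μ : Measure X) (pr : X → Y)
    (c : Finset G → Finset G → ℝ) (act : G → X → X) (α : Finset (Set X))
    (F : ℕ → Finset G) : ℝ :=
  limSeq (ascCondPartSeq μ pr c act α F)

/-- `Asc_μ^-(G,U|Y)`. -/
def AscCondMinus [MeasurableSpace X] [MeasurableSpace Y] (μ : Measure X) (pr : X → Y)
    (c : Finset G → Finset G → ℝ) (act : G → X → X) (U : Finset (Set X))
    (F : ℕ → Finset G) : ℝ :=
  limSeq fun n => (1 / ((F n).card : ℝ)) *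
    ∑ S ∈ (F n).powerset, c (F n) S * condEntCover μ pr (coverDyn act U S)

/-- `Asc_μ^+(G,U|Y)`. -/
def AscCondPlus [MeasurableSpace X] [MeasurableSpace Y] (μ : Measure X) (pr : X → Y)
    (c : Finset G → Finset G → ℝ) (act : G → X → X) (U : Finset (Set X))
    (F : ℕ → Finset G) : ℝ :=
  sInf {h | ∃ α, IsMPartition (X := X) α ∧ Refines α U ∧ h = AscCondPart μ pr c act α F}

/-- `Asc_μ(G,X|Y) = sup_α Asc_μ(G,α|Y)`. -/
def AscCondSup [MeasurableSpace X] [MeasurableSpace Y] (μ : Measure X) (pr : X → Y)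
    (c : Finset G → Finset G → ℝ) (act : G → X → X) (F : ℕ → Finset G) : ℝ :=
  sSup {h | ∃ α, IsMPartition (X := X) α ∧ h = AscCondPart μ pr c act α F}

/-- unconditional `Asc_μ(G,α)`. -/
def AscPart [MeasurableSpace X] (μ : Measure X)
    (c : Finset G → Finset G → ℝ) (act : G → X → X) (α : Finset (Set X))
    (F : ℕ → Finset G) : ℝ :=
  limSeq fun n => (1 / ((F n).card : ℝ)) *
    ∑ S ∈ (F n).powerset, c (F n) S * entPart μ (coverDyn act α S)

/-- unconditional `Asc_μ^-(G,U)`. -/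
def AscMinus [MeasurableSpace X] (μ : Measure X)
    (c : Finset G → Finset G → ℝ) (act : G → X → X) (U : Finset (Set X))
    (F : ℕ → Finset G) : ℝ :=
  limSeq fun n => (1 / ((F n).card : ℝ)) *
    ∑ S ∈ (F n).powerset, c (F n) S * entCov μ (coverDyn act U S)

/-- unconditional `Asc_μ^+(G,U)`. -/
def AscPlus [MeasurableSpace X] (μ : Measure X)
    (c : Finset G → Finset G → ℝ) (act : G → X → X) (U : Finset (Set X))
    (F : ℕ → Finset G) : ℝ :=
  sInf {h | ∃ α, IsMPartition (X := X) α ∧ Refines α U ∧ h = AscPart μ c act α F}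

/-- conditional topological average sample complexity `Asc_top(G,U|Y)`. -/
def AscTopRel (c : Finset G → Finset G → ℝ) (act : G → X → X) (pr : X → Y)
    (U : Finset (Set X)) (F : ℕ → Finset G) : ℝ :=
  limSeq fun n => (1 / ((F n).card : ℝ)) *
    ∑ S ∈ (F n).powerset, c (F n) S * Real.log (covNumRel pr (coverDyn act U S))

/-- topological average sample complexity `Asc_top(G,U)`. -/
def AscTop (c : Finset G → Finset G → ℝ) (act : G → X → X)
    (U : Finset (Set X)) (F : ℕ → Finset G) : ℝ :=
  limSeq fun n => (1 / ((F n).card : ℝ)) *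
    ∑ S ∈ (F n).powerset, c (F n) S * Real.log (covNum (coverDyn act U S) Set.univ)

/-- `ν` is `G`-invariant and ergodic for the action `act`. -/
def IsErgodicAct [MeasurableSpace X] (act : G → X → X) (ν : Measure X) : Prop :=
  (∀ g, Measure.map (act g) ν = ν) ∧
    ∀ A : Set X, MeasurableSet A → (∀ g, act g ⁻¹' A = A) → ν A = 0 ∨ ν A = 1

end GroupAsc

/-- `Asc_μ(T,α|Y)` for a `ℤ`-system, uniform coefficients `2^{-n}`. -/
def zAscCondPart [MeasurableSpace X] [MeasurableSpace Y] (μ : Measure X) (pr : X → Y)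
    (T : X → X) (α : Finset (Set X)) : ℝ :=
  limSeq fun n => (1 / (n : ℝ)) * ∑ S ∈ (Finset.range n).powerset,
    ((1 : ℝ) / 2) ^ n * condEntPart μ pr (coverIt T α S)

/-- `Asc_μ^-(T,U|Y)` for a `ℤ`-system, uniform coefficients. -/
def zAscCondMinus [MeasurableSpace X] [MeasurableSpace Y] (μ : Measure X) (pr : X → Y)
    (T : X → X) (U : Finset (Set X)) : ℝ :=
  limSeq fun n => (1 / (n : ℝ)) * ∑ S ∈ (Finset.range n).powerset,
    ((1 : ℝ) / 2) ^ n * condEntCover μ pr (coverIt T U S)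

/-- `Asc_μ^+(T,U|Y)` for a `ℤ`-system, uniform coefficients. -/
def zAscCondPlus [MeasurableSpace X] [MeasurableSpace Y] (μ : Measure X) (pr : X → Y)
    (T : X → X) (U : Finset (Set X)) : ℝ :=
  sInf {h | ∃ α, IsMPartition (X := X) α ∧ Refines α U ∧ h = zAscCondPart μ pr T α}

/-- `Asc_top(T,U|Y)` for a `ℤ`-system, uniform coefficients. -/
def zAscTop (T : X → X) (pr : X → Y) (U : Finset (Set X)) : ℝ :=
  limSeq fun n => (1 / (n : ℝ)) * ∑ S ∈ (Finset.range n).powerset,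
    ((1 : ℝ) / 2) ^ n * Real.log (covNumRel pr (coverIt T U S))

end AscLocal

open AscLocal

section OW
variable {G : Type*} [Group G] [DecidableEq G]

/-- number of points of `D` leaving `D` under left multiplication by `g`. -/
def owE (g : G) (D : Finset G) : ℕ := (D.filter fun u => g * u ∉ D).card

lemma ow_img_inv (S : Finset G) (g : G) :
    (S.image fun h => h * g).image (fun h => h * g⁻¹) = S := by
  rw [Finset.image_image]
  conv_rhs => rw [← Finset.image_id (s := S)]
  exact Finset.image_congr fun x _ => by simp

lemma ow_img_inv' (S : Finset G) (g : G) :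
    (S.image fun h => h * g⁻¹).image (fun h => h * g) = S := by
  have := ow_img_inv S g⁻¹
  rwa [inv_inv] at this

lemma owE_sdiff (g : G) (D B : Finset G) : owE g (D \ B) ≤ owE g D + owE g⁻¹ B := by
  unfold owE
  have h1 : ((D \ B).filter fun u => g * u ∉ D \ B) ⊆
      (D.filter fun u => g * u ∉ D) ∪ (B.filter fun u => g⁻¹ * u ∉ B).image (fun v => g⁻¹ * v) := by
    intro u hu
    simp only [Finset.mem_filter, Finset.mem_sdiff, Finset.mem_union, Finset.mem_image] at hu ⊢
    by_cases h : g * u ∈ D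
    · right
      refine ⟨g * u, ⟨?_, ?_⟩, ?_⟩
      · by_contra hb
        exact hu.2 ⟨h, hb⟩
      · simpa using hu.1.2
      · simp
    · left; exact ⟨hu.1.1, h⟩
  refine (Finset.card_le_card h1).trans ((Finset.card_union_le _ _).trans ?_)
  exact Nat.add_le_add_left Finset.card_image_le _

lemma owE_union (g : G) (A B : Finset G) : owE g (A ∪ B) ≤ owE g A + owE g B := by
  unfold owE
  refine le_trans (Finset.card_le_card (t := (A.filter fun u => g * u ∉ A) ∪
    (B.filter fun u => g * u ∉ B)) ?_) (Finset.card_union_le _ _)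
  intro u hu
  simp only [Finset.mem_filter, Finset.mem_union] at hu ⊢
  tauto

lemma owE_image (g c : G) (A : Finset G) : owE g (A.image fun k => k * c) = owE g A := by
  unfold owE
  rw [Finset.filter_image, Finset.card_image_of_injective _ (mul_left_injective c)]
  congr 1
  ext u
  simp only [Finset.mem_filter, Finset.mem_image, not_exists, not_and]
  refine and_congr_right fun _ => ⟨fun h hh => h _ hh (by group), fun h x hx he => h ?_⟩
  rw [← mul_assoc] at he
  rwa [← mul_right_cancel he]

lemma owE_empty (g : G) : owE g ∅ = 0 := by simp [owE]

lemma ow_interior (K D : Finset G) :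
    (D.card : ℝ) - ∑ k ∈ K, (owE k D : ℝ) ≤ ((D.filter fun c => ∀ k ∈ K, k * c ∈ D).card : ℝ) := by
  have h : D ⊆ (D.filter fun c => ∀ k ∈ K, k * c ∈ D) ∪
      K.biUnion fun k => D.filter fun u => k * u ∉ D := by
    intro u hu
    simp only [Finset.mem_filter, Finset.mem_union, Finset.mem_biUnion]
    by_cases hh : ∀ k ∈ K, k * u ∈ D
    · exact Or.inl ⟨hu, hh⟩
    · push Not at hh
      obtain ⟨k, hk, hku⟩ := hh
      exact Or.inr ⟨k, hk, hu, hku⟩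
  have h2 : D.card ≤ (D.filter fun c => ∀ k ∈ K, k * c ∈ D).card + ∑ k ∈ K, owE k D :=
    (Finset.card_le_card h).trans ((Finset.card_union_le _ _).trans
      (Nat.add_le_add_left Finset.card_biUnion_le _))
  have h3 : (D.card : ℝ) ≤ ((D.filter fun c => ∀ k ∈ K, k * c ∈ D).card : ℝ)
      + ∑ k ∈ K, (owE k D : ℝ) := by exact_mod_cast h2
  linarith

lemma ow_count (K B I : Finset G) (ε : ℝ) (hK : K.Nonempty)
    (h : ∀ c ∈ I, ε * K.card ≤ (((K.image fun k => k * c) ∩ B).card : ℝ)) :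
    ε * I.card ≤ B.card := by
  have h1 : ∑ c ∈ I, ((K.image fun k => k * c) ∩ B).card ≤ K.card * B.card := by
    have : ∀ c ∈ I, ((K.image fun k => k * c) ∩ B).card
        = ∑ b ∈ B, if b ∈ K.image (fun k => k * c) then 1 else 0 := by
      intro c _
      rw [← Finset.card_filter]
      congr 1
      ext x
      simp only [Finset.mem_inter, Finset.mem_filter]
      tauto
    rw [Finset.sum_congr rfl this, Finset.sum_comm, mul_comm, ← smul_eq_mul]
    refine Finset.sum_le_card_nsmul _ _ _ fun b _ => ?_
    rw [← Finset.card_filter]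
    have : (I.filter fun c => b ∈ K.image (fun k => k * c)) ⊆ K.image fun k => k⁻¹ * b := by
      intro c hc
      simp only [Finset.mem_filter, Finset.mem_image] at hc ⊢
      obtain ⟨_, k, hk, rfl⟩ := hc
      exact ⟨k, hk, by simp⟩
    exact (Finset.card_le_card this).trans Finset.card_image_le
  have h2 : (I.card : ℝ) * (ε * K.card) ≤ K.card * B.card := by
    have : ∑ c ∈ I, (ε * K.card) ≤ ∑ c ∈ I, (((K.image fun k => k * c) ∩ B).card : ℝ) :=
      Finset.sum_le_sum h
    rw [Finset.sum_const, nsmul_eq_mul] at this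
    refine this.trans ?_
    exact_mod_cast h1
  have hk : (0 : ℝ) < K.card := by exact_mod_cast hK.card_pos
  by_contra hc
  push Not at hc
  nlinarith

variable (h : Finset G → ℝ) (h0 : h ∅ = 0) (hmono : ∀ A B, A ⊆ B → h A ≤ h B)
  (hinv : ∀ A (g : G), h (A.image fun k => k * g) = h A)
  (hsub : ∀ A B, h (A ∪ B) ≤ h A + h B)

include h0 hinv hsub in
lemma ow_fill (K D : Finset G) (hK : K.Nonempty) (ε : ℝ) (hε : ε < 1) :
    ∃ (n : ℕ) (B : Finset G), B ⊆ D ∧ n * ((1 - ε) * K.card) ≤ (B.card : ℝ) ∧ h B ≤ n * h K ∧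
      (∀ g, owE g B ≤ n * owE g K) ∧
      ε * ((D.filter fun c => ∀ k ∈ K, k * c ∈ D).card : ℝ) ≤ B.card := by
  classical
  have hk : (0 : ℝ) < K.card := by exact_mod_cast hK.card_pos
  have hk1 : 0 < (1 - ε) * K.card := mul_pos (by linarith) hk
  let P : ℕ → Prop := fun n => ∃ B : Finset G, B ⊆ D ∧ n * ((1 - ε) * K.card) ≤ (B.card : ℝ) ∧
      h B ≤ n * h K ∧ (∀ g, owE g B ≤ n * owE g K)
  have hP0 : P 0 := ⟨∅, by simp, by simp, by simp [h0], by simp [owE_empty]⟩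
  obtain ⟨N, hN⟩ := exists_nat_gt ((D.card : ℝ) / ((1 - ε) * K.card))
  have hbd : ∀ n, P n → n ≤ N := by
    rintro n ⟨B, hBD, hB, -⟩
    have h1 : (B.card : ℝ) ≤ D.card := by exact_mod_cast Finset.card_le_card hBD
    have h2 : (n : ℝ) ≤ (D.card : ℝ) / ((1 - ε) * K.card) := by
      rw [le_div_iff₀ hk1]; linarith
    exact_mod_cast (h2.trans hN.le)
  have hmax : P (Nat.findGreatest P N) := Nat.findGreatest_spec (Nat.zero_le N) hP0
  set n := Nat.findGreatest P N with hn
  have hnot : ¬ P (n + 1) := fun hp => by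
    have := Nat.le_findGreatest (hbd _ hp) hp
    omega
  obtain ⟨B, hBD, hB, hhB, hEB⟩ := hmax
  refine ⟨n, B, hBD, hB, hhB, hEB, ow_count K B _ ε hK fun c hc => ?_⟩
  by_contra hlt
  push Not at hlt
  apply hnot
  simp only [Finset.mem_filter] at hc
  refine ⟨B ∪ K.image fun k => k * c, ?_, ?_, ?_, ?_⟩
  · refine Finset.union_subset hBD ?_
    intro x hx
    obtain ⟨k, hk, rfl⟩ := Finset.mem_image.1 hx
    exact hc.2 k hk
  · have h1 := Finset.card_union_add_card_inter B (K.image fun k => k * c)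
    rw [Finset.inter_comm, Finset.card_image_of_injective _ (mul_left_injective c)] at h1
    have h2 : ((B ∪ K.image fun k => k * c).card : ℝ) + ((K.image fun k => k * c) ∩ B).card
      = B.card + K.card := by exact_mod_cast h1
    push_cast
    linarith
  · have h1 := hsub B (K.image fun k => k * c)
    rw [hinv] at h1
    push_cast
    linarith
  · intro g
    have h1 := owE_union g B (K.image fun k => k * c)
    rw [owE_image] at h1
    have := hEB g
    rw [add_mul]; omega

/-- arbitrarily invariant sets with `h K ≤ a |K|` exist. -/
def owTiles (a : ℝ) : Prop :=
  ∀ (S : Finset G) (η : ℝ), 0 < η → ∃ K : Finset G, K.Nonempty ∧ h K ≤ a * K.card ∧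
    ∀ g ∈ S, (owE g K : ℝ) ≤ η * K.card

include h0 hinv hsub in
lemma ow_card (A : Finset G) : h A ≤ h {1} * A.card := by
  induction A using Finset.induction_on with
  | empty => simp [h0]
  | insert x s hx ih =>
    have h1 := hsub {x} s
    have h2 := hinv {1} x
    simp only [Finset.image_singleton, one_mul] at h2
    rw [Finset.card_insert_of_notMem hx, Finset.insert_eq]
    push_cast
    linarith

include h0 hmono hinv hsub in
lemma ow_step (a ε θ : ℝ) (ha : 0 ≤ a) (hε0 : 0 < ε) (hε : ε < 1) (hθ : 0 < θ)
    (hT : owTiles h a) (s : ℕ) :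
    ∃ (S : Finset G) (η : ℝ), 0 < η ∧ ∀ (D : Finset G) (m : ℝ), (D.card : ℝ) ≤ m →
      (∀ g ∈ S, (owE g D : ℝ) ≤ η * m) →
      h D ≤ a / (1 - ε) * D.card + h {1} * (θ + (1 - ε / 2) ^ s) * m := by
  have hM : 0 ≤ h {1} := by rw [← h0]; exact hmono _ _ (by simp)
  have ha' : 0 ≤ a / (1 - ε) := div_nonneg ha (by linarith)
  have hcard := ow_card h h0 hinv hsub
  induction s with
  | zero =>
    refine ⟨∅, 1, one_pos, fun D m hD _ => ?_⟩
    have hm : 0 ≤ m := (Nat.cast_nonneg _).trans hD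
    have h1 : h {1} * D.card ≤ h {1} * m := mul_le_mul_of_nonneg_left hD hM
    have h2 : 0 ≤ a / (1 - ε) * D.card := by positivity
    have h3 : 0 ≤ h {1} * θ * m := by positivity
    have := hcard D
    simp only [pow_zero]
    nlinarith
  | succ s ih =>
    obtain ⟨S, η, hη, ih⟩ := ih
    have hρ : 0 < 1 - ε / 2 := by linarith
    have hε' : 0 < 1 - ε := by linarith
    obtain ⟨K, hKne, hKh, hKE⟩ := hT (S.image fun g => g⁻¹)
      (η * (1 - ε / 2) / 2 * (1 - ε)) (by positivity)
    have hk : (0 : ℝ) < K.card := by exact_mod_cast hKne.card_pos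
    refine ⟨S ∪ K, min (η * (1 - ε / 2) / 2) (θ / (2 * K.card)), by positivity,
      fun D m hD hDE => ?_⟩
    set η' := min (η * (1 - ε / 2) / 2) (θ / (2 * K.card)) with hη'
    have hm : 0 ≤ m := (Nat.cast_nonneg _).trans hD
    by_cases hsmall : (D.card : ℝ) ≤ θ * m
    · have h1 : h {1} * D.card ≤ h {1} * (θ * m) := mul_le_mul_of_nonneg_left hsmall hM
      have h2 : 0 ≤ a / (1 - ε) * D.card := by positivity
      have h3 : 0 ≤ h {1} * (1 - ε / 2) ^ (s + 1) * m := by positivity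
      have := hcard D
      nlinarith
    push Not at hsmall
    obtain ⟨n, B, hBD, hnB, hhB, hEB, hfill⟩ := ow_fill h h0 hinv hsub K D hKne ε hε
    have hint := ow_interior K D
    have hBc : (B.card : ℝ) ≤ D.card := by exact_mod_cast Finset.card_le_card hBD
    have hsum : ∑ k ∈ K, (owE k D : ℝ) ≤ D.card / 2 := by
      calc ∑ k ∈ K, (owE k D : ℝ) ≤ ∑ k ∈ K, θ / (2 * K.card) * m := by
            refine Finset.sum_le_sum fun k hk => (hDE k (Finset.mem_union_right _ hk)).trans ?_
            exact mul_le_mul_of_nonneg_right (min_le_right _ _) hm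
        _ = θ * m / 2 := by
            rw [Finset.sum_const, nsmul_eq_mul]; field_simp
        _ ≤ _ := by linarith
    have hBbig : ε / 2 * D.card ≤ B.card := by nlinarith
    have hDB : ((D \ B).card : ℝ) = D.card - B.card := by
      rw [Finset.card_sdiff_of_subset hBD, Nat.cast_sub (Finset.card_le_card hBD)]
    have hih := ih (D \ B) ((1 - ε / 2) * m) (by rw [hDB]; nlinarith) (by
      intro g hg
      have h1 : (owE g (D \ B) : ℝ) ≤ owE g D + owE g⁻¹ B := by exact_mod_cast owE_sdiff g D B
      have h2 : (owE g D : ℝ) ≤ η * (1 - ε / 2) / 2 * m :=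
        (hDE g (Finset.mem_union_left _ hg)).trans
          (mul_le_mul_of_nonneg_right (min_le_left _ _) hm)
      have h3 : (owE g⁻¹ B : ℝ) ≤ n * owE g⁻¹ K := by exact_mod_cast hEB g⁻¹
      have h4 := hKE g⁻¹ (Finset.mem_image_of_mem _ hg)
      have h5 : (n : ℝ) * owE g⁻¹ K ≤ n * (η * (1 - ε / 2) / 2 * (1 - ε) * K.card) :=
        mul_le_mul_of_nonneg_left h4 (Nat.cast_nonneg _)
      have h6 : η * (1 - ε / 2) / 2 * (n * ((1 - ε) * K.card)) ≤ η * (1 - ε / 2) / 2 * m :=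
        mul_le_mul_of_nonneg_left (by linarith) (by positivity)
      nlinarith)
    have hB2 : h B ≤ a / (1 - ε) * B.card := by
      calc h B ≤ n * h K := hhB
        _ ≤ n * (a * K.card) := mul_le_mul_of_nonneg_left hKh (Nat.cast_nonneg _)
        _ = a / (1 - ε) * (n * ((1 - ε) * K.card)) := by field_simp
        _ ≤ _ := mul_le_mul_of_nonneg_left hnB ha'
    have hD2 : h D ≤ h B + h (D \ B) := by
      have := hsub B (D \ B)
      rwa [Finset.union_sdiff_of_subset hBD] at this
    have h7 : h {1} * θ * ((1 - ε / 2) * m) ≤ h {1} * θ * m :=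
      mul_le_mul_of_nonneg_left (by nlinarith) (by positivity)
    rw [hDB] at hih
    rw [pow_succ]
    nlinarith

include h0 hmono hinv hsub in
lemma ow_upper (a δ : ℝ) (ha : 0 ≤ a) (hδ : 0 < δ) (hT : owTiles h a) :
    ∃ (S : Finset G) (η : ℝ), 0 < η ∧ ∀ (D : Finset G),
      (∀ g ∈ S, (owE g D : ℝ) ≤ η * D.card) → h D ≤ (a + δ) * D.card := by
  have hM : 0 ≤ h {1} := by rw [← h0]; exact hmono _ _ (by simp)
  obtain ⟨ε, hε0, hε1, hε⟩ : ∃ ε : ℝ, 0 < ε ∧ ε < 1 ∧ a / (1 - ε) ≤ a + δ / 2 := by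
    refine ⟨δ / (2 * (a + δ)), by positivity, ?_, ?_⟩
    · rw [div_lt_one (by positivity)]; linarith
    · have : 1 - δ / (2 * (a + δ)) = (2 * a + δ) / (2 * (a + δ)) := by
        field_simp; ring
      rw [this, div_div_eq_mul_div, div_le_iff₀ (by positivity)]
      nlinarith [sq_nonneg δ, mul_nonneg ha hδ.le]
  have hM1 : 0 < h {1} + 1 := by linarith
  obtain ⟨s, hs⟩ := exists_pow_lt_of_lt_one (show 0 < δ / (4 * (h {1} + 1)) by positivity)
    (show 1 - ε / 2 < 1 by linarith)
  obtain ⟨S, η, hη, hS⟩ := ow_step h h0 hmono hinv hsub a ε (δ / (4 * (h {1} + 1))) ha hε0 hε1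
    (by positivity) hT s
  refine ⟨S, η, hη, fun D hD => (hS D D.card le_rfl hD).trans ?_⟩
  rw [← add_mul]
  refine mul_le_mul_of_nonneg_right ?_ (Nat.cast_nonneg _)
  have h1 : h {1} * (δ / (4 * (h {1} + 1)) + (1 - ε / 2) ^ s) ≤
      h {1} * (δ / (4 * (h {1} + 1)) + δ / (4 * (h {1} + 1))) :=
    mul_le_mul_of_nonneg_left (by linarith) hM
  have h2 : h {1} * (δ / (4 * (h {1} + 1)) + δ / (4 * (h {1} + 1))) ≤ δ / 2 := by
    have : δ / (4 * (h {1} + 1)) + δ / (4 * (h {1} + 1)) = δ / 2 / (h {1} + 1) := by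
      field_simp; norm_num
    rw [this, mul_div_assoc', div_le_iff₀ hM1]
    nlinarith
  linarith

lemma ow_folner (F : ℕ → Finset G) (hF : IsFolner F) (S : Finset G) (η : ℝ) (hη : 0 < η) :
    ∀ᶠ n in atTop, ∀ g ∈ S, (owE g (F n) : ℝ) ≤ η * (F n).card := by
  rw [Filter.eventually_all_finset]
  intro g _
  filter_upwards [(hF.2 g).eventually_lt_const hη] with n hn
  have hpos : (0 : ℝ) < (F n).card := by exact_mod_cast (hF.1 n).card_pos
  rw [div_lt_iff₀ hpos] at hn
  refine le_trans ?_ hn.le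
  have : owE g (F n) ≤ (((F n).image fun h => g * h) \ F n).card := by
    unfold owE
    rw [← Finset.card_image_of_injective _ (mul_right_injective g)]
    refine Finset.card_le_card ?_
    intro x hx
    simp only [Finset.mem_image, Finset.mem_filter, Finset.mem_sdiff] at hx ⊢
    obtain ⟨u, ⟨hu, hgu⟩, rfl⟩ := hx
    exact ⟨⟨u, hu, rfl⟩, hgu⟩
  exact_mod_cast this.trans (Finset.card_le_card Finset.subset_union_left)

include h0 hmono hinv hsub in
lemma ow_main (hG : ∃ F : ℕ → Finset G, IsFolner F) :
    ∃ L : ℝ, ∀ F : ℕ → Finset G, IsFolner F →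
        Tendsto (fun n => (1 / ((F n).card : ℝ)) * h (F n)) atTop (nhds L) := by
  have hnn : ∀ A, 0 ≤ h A := fun A => by rw [← h0]; exact hmono _ _ (by simp)
  have hT0 : ∀ a, owTiles h a → 0 ≤ a := by
    intro a ha
    obtain ⟨K, hK, hKh, -⟩ := ha ∅ 1 one_pos
    have hk : (0 : ℝ) < K.card := by exact_mod_cast hK.card_pos
    exact nonneg_of_mul_nonneg_left ((hnn K).trans hKh) hk
  have hbdd : BddBelow {a | owTiles h a} := ⟨0, hT0⟩
  have hne : {a | owTiles h a}.Nonempty := by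
    obtain ⟨F, hF⟩ := hG
    refine ⟨h {1}, fun S η hη => ?_⟩
    obtain ⟨n, hn⟩ := (ow_folner F hF S η hη).exists
    exact ⟨F n, hF.1 n, ow_card h h0 hinv hsub _, hn⟩
  refine ⟨sInf {a | owTiles h a}, fun F hF => ?_⟩
  have hpos : ∀ n, (0 : ℝ) < (F n).card := fun n => by exact_mod_cast (hF.1 n).card_pos
  refine tendsto_order.2 ⟨fun b hb => ?_, fun b hb => ?_⟩
  · by_contra hc
    rw [Filter.not_eventually] at hc
    have : owTiles h b := by
      intro S η hη
      obtain ⟨n, hn, hn2⟩ := (hc.and_eventually (ow_folner F hF S η hη)).exists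
      refine ⟨F n, hF.1 n, ?_, hn2⟩
      rw [not_lt, one_div, inv_mul_le_iff₀ (hpos n)] at hn
      linarith
    exact absurd (csInf_le hbdd this) (not_le.2 hb)
  · obtain ⟨a, ha, hab⟩ := exists_lt_of_csInf_lt hne hb
    obtain ⟨S, η, hη, hS⟩ := ow_upper h h0 hmono hinv hsub a ((b - a) / 2) (hT0 a ha)
      (by linarith) ha
    filter_upwards [ow_folner F hF S η hη] with n hn
    have := hS (F n) hn
    rw [one_div, inv_mul_lt_iff₀ (hpos n)]
    have := hpos n
    nlinarith

end OW

section Cov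
variable {G X Y : Type*} [Group G] [DecidableEq G]

lemma mem_coverDyn (act : G → X → X) (U : Finset (Set X)) (S : Finset G) (A : Set X) :
    A ∈ coverDyn act U S ↔
      ∃ f : G → Set X, (∀ g ∈ S, f g ∈ U) ∧ A = {x | ∀ g ∈ S, act g x ∈ f g} := by
  classical
  unfold coverDyn
  simp only [Finset.mem_image, Finset.mem_pi]
  constructor
  · rintro ⟨f, hf, rfl⟩
    refine ⟨fun g => if h : g ∈ S then f g h else ∅, fun g hg => by simpa [hg] using hf g hg, ?_⟩
    ext x
    simp only [mem_iInter, mem_preimage, mem_ofPred_eq]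
    exact forall₂_congr fun g hg => by simp [hg]
  · rintro ⟨f, hf, rfl⟩
    refine ⟨fun g _ => f g, hf, ?_⟩
    ext x
    simp

lemma coverDyn_cover (act : G → X → X) (U : Finset (Set X)) (hU : IsCover U) (S : Finset G) :
    IsCover (coverDyn act U S) := by
  refine Set.eq_univ_of_forall fun x => ?_
  have : ∀ g : G, ∃ A ∈ U, act g x ∈ A := fun g => by
    have : act g x ∈ ⋃₀ (U : Set (Set X)) := by
      unfold IsCover at hU; rw [hU]; trivial
    simpa using this
  choose f hf hfx using this
  exact ⟨_, (mem_coverDyn act U S _).2 ⟨f, fun g _ => hf g, rfl⟩, fun g _ => hfx g⟩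

lemma covNum_le (W V : Finset (Set X)) (K : Set X) (hV : V ⊆ W)
    (hK : K ⊆ ⋃₀ (V : Set (Set X))) : covNum W K ≤ V.card :=
  Nat.sInf_le ⟨V, hV, rfl, hK⟩

lemma covNum_exists (W : Finset (Set X)) (hW : IsCover W) (K : Set X) :
    ∃ V : Finset (Set X), V ⊆ W ∧ V.card = covNum W K ∧ K ⊆ ⋃₀ (V : Set (Set X)) := by
  have hne : {n | ∃ V : Finset (Set X), V ⊆ W ∧ V.card = n ∧
      K ⊆ ⋃₀ (V : Set (Set X))}.Nonempty :=
    ⟨_, W, subset_rfl, rfl, by unfold IsCover at hW; rw [hW]; exact subset_univ _⟩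
  exact Nat.sInf_mem hne

lemma covNumRel_le (pr : X → Y) (W : Finset (Set X)) (b : ℕ)
    (h : ∀ y, covNum W (pr ⁻¹' {y}) ≤ b) : covNumRel pr W ≤ b := by
  refine csSup_le' ?_
  rintro n ⟨y, rfl⟩
  exact h y

lemma le_covNumRel (pr : X → Y) (W : Finset (Set X)) (hW : IsCover W) (y : Y) :
    covNum W (pr ⁻¹' {y}) ≤ covNumRel pr W := by
  refine le_csSup ⟨W.card, ?_⟩ ⟨y, rfl⟩
  rintro n ⟨y, rfl⟩
  exact covNum_le _ _ _ subset_rfl (by unfold IsCover at hW; rw [hW]; exact subset_univ _)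

variable (act : G → X → X) (pr : X → Y) (U : Finset (Set X)) (hU : IsCover U)

include hU in
lemma N_mono (S T : Finset G) (hST : S ⊆ T) :
    covNumRel pr (coverDyn act U S) ≤ covNumRel pr (coverDyn act U T) := by
  classical
  refine covNumRel_le _ _ _ fun y => le_trans ?_ (le_covNumRel pr _ (coverDyn_cover act U hU T) y)
  obtain ⟨V, hV, hc, hK⟩ := covNum_exists _ (coverDyn_cover act U hU T) (pr ⁻¹' {y})
  have : ∀ A : Set X, ∃ B, A ∈ V → B ∈ coverDyn act U S ∧ A ⊆ B := by
    intro A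
    by_cases hA : A ∈ V
    · obtain ⟨f, hf, rfl⟩ := (mem_coverDyn act U T A).1 (hV hA)
      exact ⟨_, fun _ => ⟨(mem_coverDyn act U S _).2 ⟨f, fun g hg => hf g (hST hg), rfl⟩,
        fun x hx g hg => hx g (hST hg)⟩⟩
    · exact ⟨∅, fun h => absurd h hA⟩
  choose p hp using this
  rw [← hc]
  refine (covNum_le _ (V.image p) _ ?_ ?_).trans Finset.card_image_le
  · intro B hB
    obtain ⟨A, hA, rfl⟩ := Finset.mem_image.1 hB
    exact (hp A hA).1
  · intro x hx
    obtain ⟨A, hA, hxA⟩ := hK hx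
    exact ⟨p A, by simpa using ⟨A, hA, rfl⟩, (hp A hA).2 hxA⟩

include hU in
lemma N_union (S T : Finset G) :
    covNumRel pr (coverDyn act U (S ∪ T)) ≤
      covNumRel pr (coverDyn act U S) * covNumRel pr (coverDyn act U T) := by
  classical
  refine covNumRel_le _ _ _ fun y => le_trans ?_ (Nat.mul_le_mul
    (le_covNumRel pr _ (coverDyn_cover act U hU S) y)
    (le_covNumRel pr _ (coverDyn_cover act U hU T) y))
  obtain ⟨V, hV, hc, hK⟩ := covNum_exists _ (coverDyn_cover act U hU S) (pr ⁻¹' {y})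
  obtain ⟨V', hV', hc', hK'⟩ := covNum_exists _ (coverDyn_cover act U hU T) (pr ⁻¹' {y})
  have : ∀ A : Set X × Set X, ∃ B, A ∈ V ×ˢ V' →
      B ∈ coverDyn act U (S ∪ T) ∧ A.1 ∩ A.2 ⊆ B := by
    rintro ⟨A, A'⟩
    by_cases hA : (A, A') ∈ V ×ˢ V'
    · obtain ⟨hA1, hA2⟩ := Finset.mem_product.1 hA
      obtain ⟨f, hf, rfl⟩ := (mem_coverDyn act U S A).1 (hV hA1)
      obtain ⟨f', hf', rfl⟩ := (mem_coverDyn act U T A').1 (hV' hA2)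
      refine ⟨_, fun _ => ⟨(mem_coverDyn act U _ _).2
        ⟨fun g => if g ∈ S then f g else f' g, fun g hg => ?_, rfl⟩, ?_⟩⟩
      · by_cases h : g ∈ S
        · simpa [h] using hf g h
        · simpa [h] using hf' g ((Finset.mem_union.1 hg).resolve_left h)
      · rintro x ⟨hx, hx'⟩ g hg
        by_cases h : g ∈ S
        · simpa [h] using hx g h
        · simpa [h] using hx' g ((Finset.mem_union.1 hg).resolve_left h)
    · exact ⟨∅, fun h => absurd h hA⟩
  choose p hp using this
  rw [← hc, ← hc', ← Finset.card_product]
  refine (covNum_le _ ((V ×ˢ V').image p) _ ?_ ?_).trans Finset.card_image_le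
  · intro B hB
    obtain ⟨A, hA, rfl⟩ := Finset.mem_image.1 hB
    exact (hp A hA).1
  · intro x hx
    obtain ⟨A, hA, hxA⟩ := hK hx
    obtain ⟨A', hA', hxA'⟩ := hK' hx
    have hm : (A, A') ∈ V ×ˢ V' := Finset.mem_product.2 ⟨hA, hA'⟩
    exact ⟨p (A, A'), Finset.mem_coe.2 (Finset.mem_image_of_mem _ hm), (hp _ hm).2 ⟨hxA, hxA'⟩⟩

lemma N_empty : covNumRel pr (coverDyn act U ∅) ≤ 1 := by
  classical
  refine covNumRel_le _ _ _ fun y => ?_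
  refine (covNum_le _ {Set.univ} _ ?_ ?_).trans (by simp)
  · intro A hA
    rw [Finset.mem_singleton.1 hA]
    exact (mem_coverDyn act U ∅ _).2 ⟨fun _ => ∅, by simp, by simp⟩
  · simp

variable (hactm : ∀ g h : G, ∀ x : X, act (g * h) x = act g (act h x))
    (actY : G → Y → Y) (hfac : ∀ (g : G) (x : X), pr (act g x) = actY g (pr x))

include hU hactm hfac in
lemma N_inv_le (S : Finset G) (g : G) :
    covNumRel pr (coverDyn act U (S.image fun h => h * g)) ≤ covNumRel pr (coverDyn act U S) := by
  classical
  refine covNumRel_le _ _ _ fun y => le_trans ?_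
    (le_covNumRel pr _ (coverDyn_cover act U hU S) (actY g y))
  obtain ⟨V, hV, hc, hK⟩ := covNum_exists _ (coverDyn_cover act U hU S) (pr ⁻¹' {actY g y})
  rw [← hc]
  refine (covNum_le _ (V.image fun A => act g ⁻¹' A) _ ?_ ?_).trans Finset.card_image_le
  · intro B hB
    obtain ⟨A, hA, rfl⟩ := Finset.mem_image.1 hB
    obtain ⟨f, hf, rfl⟩ := (mem_coverDyn act U S A).1 (hV hA)
    refine (mem_coverDyn act U _ _).2 ⟨fun t => f (t * g⁻¹), ?_, ?_⟩
    · intro t ht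
      obtain ⟨s, hs, rfl⟩ := Finset.mem_image.1 ht
      simpa using hf s hs
    · ext x
      simp only [mem_preimage, mem_ofPred_eq, Finset.forall_mem_image, hactm, mul_inv_cancel_right]
  · intro x hx
    have hx' : act g x ∈ pr ⁻¹' {actY g y} := by
      simp only [mem_preimage, mem_singleton_iff] at hx ⊢
      rw [hfac, hx]
    obtain ⟨A, hA, hxA⟩ := hK hx'
    exact ⟨_, Finset.mem_coe.2 (Finset.mem_image_of_mem _ hA), hxA⟩

include hU hactm hfac in
lemma N_inv (S : Finset G) (g : G) :
    covNumRel pr (coverDyn act U (S.image fun h => h * g)) = covNumRel pr (coverDyn act U S) := by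
  refine le_antisymm (N_inv_le act pr U hU hactm actY hfac S g) ?_
  have := N_inv_le act pr U hU hactm actY hfac (S.image fun h => h * g) g⁻¹
  rwa [ow_img_inv] at this

end Cov

section Coef
variable {G : Type*} [Group G] [DecidableEq G] (lam : Measure ℝ) (hlam : IsCoeffMeasure lam)

include hlam in
lemma coeff_ae : ∀ᵐ x ∂lam, 0 ≤ x ∧ x ≤ 1 := by
  have := hlam.2.1
  exact this

include hlam in
lemma coeff_nonneg' (A S : Finset G) : 0 ≤ coeff lam A S := by
  refine integral_nonneg_of_ae ?_
  filter_upwards [coeff_ae lam hlam] with x hx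
  have : 0 ≤ 1 - x := by linarith [hx.2]
  have := hx.1
  simp only [Pi.zero_apply]
  positivity

include hlam in
lemma coeff_integrable (a b : ℕ) : Integrable (fun x : ℝ => x ^ a * (1 - x) ^ b) lam := by
  have := hlam.1
  refine Integrable.of_bound (C := 1) (by fun_prop) ?_
  filter_upwards [coeff_ae lam hlam] with x hx
  have h0 : 0 ≤ 1 - x := by linarith [hx.2]
  have h1 : x ^ a ≤ 1 := pow_le_one₀ hx.1 hx.2
  have h2 : (1 - x) ^ b ≤ 1 := pow_le_one₀ h0 (by linarith [hx.1])
  have h3 := hx.1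
  rw [Real.norm_of_nonneg (by positivity)]
  exact mul_le_one₀ h1 (by positivity) h2

include hlam in
lemma coeff_sum (E F S : Finset G) (hEF : Disjoint E F) (hS : S ⊆ E) :
    ∑ T ∈ F.powerset, coeff lam (E ∪ F) (S ∪ T) = coeff lam E S := by
  unfold coeff
  rw [← integral_finsetSum _ fun T _ => coeff_integrable lam hlam _ _]
  congr 1
  ext x
  have : ∀ T ∈ F.powerset, x ^ (S ∪ T).card * (1 - x) ^ ((E ∪ F).card - (S ∪ T).card)
      = (x ^ S.card * (1 - x) ^ (E.card - S.card)) * (x ^ T.card * (1 - x) ^ (F.card - T.card)) := by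
    intro T hT
    rw [Finset.mem_powerset] at hT
    rw [Finset.card_union_of_disjoint hEF,
      Finset.card_union_of_disjoint (Finset.disjoint_of_subset_left hS
        (Finset.disjoint_of_subset_right hT hEF))]
    have h1 := Finset.card_le_card hS
    have h2 := Finset.card_le_card hT
    rw [show E.card + F.card - (S.card + T.card) = (E.card - S.card) + (F.card - T.card) by omega]
    ring
  rw [Finset.sum_congr rfl this, ← Finset.mul_sum, Finset.sum_pow_mul_eq_add_pow]
  simp

lemma sum_powerset_union' (E F : Finset G) (hEF : Disjoint E F) (f : Finset G → ℝ) :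
    ∑ R ∈ (E ∪ F).powerset, f R = ∑ S ∈ E.powerset, ∑ T ∈ F.powerset, f (S ∪ T) := by
  rw [← Finset.sum_product']
  symm
  refine Finset.sum_nbij' (fun p => p.1 ∪ p.2) (fun R => (R ∩ E, R ∩ F)) ?_ ?_ ?_ ?_ ?_
  · rintro ⟨S, T⟩ h
    simp only [Finset.mem_product, Finset.mem_powerset] at h ⊢
    exact Finset.union_subset_union h.1 h.2
  · intro R _
    simp [Finset.inter_subset_right]
  · rintro ⟨S, T⟩ h
    simp only [Finset.mem_product, Finset.mem_powerset] at h
    rw [Finset.disjoint_left] at hEF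
    have h1 := h.1
    have h2 := h.2
    ext x <;> simp only [Finset.mem_inter, Finset.mem_union]
    · have a := @h1 x; have b := @h2 x; have c := @hEF x; tauto
    · have a := @h1 x; have b := @h2 x; have c := @hEF x; tauto
  · intro R h
    simp only [Finset.mem_powerset] at h
    simp only [← Finset.inter_union_distrib_left]
    exact Finset.inter_eq_left.2 h
  · intros; rfl

variable (N : Finset G → ℝ) (hN0 : ∀ S, 0 ≤ N S) (hNm : ∀ S T, S ⊆ T → N S ≤ N T)
  (hNu : ∀ S T, N (S ∪ T) ≤ N S + N T) (hNi : ∀ S (g : G), N (S.image fun h => h * g) = N S)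

/-- the averaged set function -/
def owPhi (E : Finset G) : ℝ := ∑ S ∈ E.powerset, coeff lam E S * N S

include hlam in
lemma owPhi_left (E F : Finset G) (hEF : Disjoint E F) :
    owPhi lam N E = ∑ S ∈ E.powerset, ∑ T ∈ F.powerset, coeff lam (E ∪ F) (S ∪ T) * N S := by
  refine Finset.sum_congr rfl fun S hS => ?_
  rw [← Finset.sum_mul, coeff_sum lam hlam E F S hEF (Finset.mem_powerset.1 hS)]

include hlam in
lemma owPhi_right (E F : Finset G) (hEF : Disjoint E F) :
    owPhi lam N F = ∑ S ∈ E.powerset, ∑ T ∈ F.powerset, coeff lam (E ∪ F) (S ∪ T) * N T := by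
  rw [owPhi_left lam hlam N F E hEF.symm, Finset.sum_comm]
  refine Finset.sum_congr rfl fun S _ => Finset.sum_congr rfl fun T _ => ?_
  rw [Finset.union_comm F E, Finset.union_comm T S]

include hlam hN0 in
lemma owPhi_nonneg (E : Finset G) : 0 ≤ owPhi lam N E :=
  Finset.sum_nonneg fun S _ => mul_nonneg (coeff_nonneg' lam hlam E S) (hN0 S)

include hlam hNm in
lemma owPhi_mono (E F : Finset G) (h : E ⊆ F) : owPhi lam N E ≤ owPhi lam N F := by
  have hd : Disjoint E (F \ E) := Finset.disjoint_sdiff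
  rw [owPhi_left lam hlam N E (F \ E) hd]
  conv_rhs => rw [← Finset.union_sdiff_of_subset h]
  unfold owPhi
  rw [sum_powerset_union' _ _ hd]
  exact Finset.sum_le_sum fun S _ => Finset.sum_le_sum fun T _ =>
    mul_le_mul_of_nonneg_left (hNm _ _ Finset.subset_union_left) (coeff_nonneg' lam hlam _ _)

include hlam hNu in
lemma owPhi_sub (E F : Finset G) (hd : Disjoint E F) :
    owPhi lam N (E ∪ F) ≤ owPhi lam N E + owPhi lam N F := by
  rw [owPhi_left lam hlam N E F hd, owPhi_right lam hlam N E F hd]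
  unfold owPhi
  rw [sum_powerset_union' _ _ hd, ← Finset.sum_add_distrib]
  refine Finset.sum_le_sum fun S _ => ?_
  rw [← Finset.sum_add_distrib]
  refine Finset.sum_le_sum fun T _ => ?_
  rw [← mul_add]
  exact mul_le_mul_of_nonneg_left (hNu _ _) (coeff_nonneg' lam hlam _ _)

include hNi in
lemma owPhi_inv (E : Finset G) (g : G) :
    owPhi lam N (E.image fun h => h * g) = owPhi lam N E := by
  unfold owPhi
  symm
  refine Finset.sum_nbij' (fun S => S.image fun h => h * g) (fun S => S.image fun h => h * g⁻¹)
    ?_ ?_ ?_ ?_ ?_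
  · intro S hS
    rw [Finset.mem_powerset] at hS ⊢
    exact Finset.image_subset_image hS
  · intro S hS
    rw [Finset.mem_powerset] at hS ⊢
    have := Finset.image_subset_image (f := fun h => h * g⁻¹) hS
    rwa [ow_img_inv] at this
  · intro S _
    exact ow_img_inv S g
  · intro S _
    exact ow_img_inv' S g
  · intro S _
    rw [hNi]
    unfold coeff
    rw [Finset.card_image_of_injective _ (mul_left_injective g),
      Finset.card_image_of_injective _ (mul_left_injective g)]

end Coef

theorem statement0 {G X Y : Type*} [Group G] [DecidableEq G] [Countable G] [Infinite G]
    [MetricSpace X] [CompactSpace X] [MeasurableSpace X] [BorelSpace X]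
    [MetricSpace Y] [CompactSpace Y] [MeasurableSpace Y] [BorelSpace Y]
    (act : G → X → X) (hactc : ∀ g : G, Continuous (act g))
    (hact1 : ∀ x : X, act 1 x = x)
    (hactm : ∀ g h : G, ∀ x : X, act (g * h) x = act g (act h x))
    (actY : G → Y → Y) (hactYc : ∀ g : G, Continuous (actY g))
    (hactY1 : ∀ y : Y, actY 1 y = y)
    (hactYm : ∀ g h : G, ∀ y : Y, actY (g * h) y = actY g (actY h y))
    (π : X → Y) (hπc : Continuous π) (hπs : Function.Surjective π)
    (hfac : ∀ (g : G) (x : X), π (act g x) = actY g (π x))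
    (U : Finset (Set X)) (hUc : IsCover U) (hUm : ∀ A ∈ U, MeasurableSet A)
    (lam : Measure ℝ) (hlam : IsCoeffMeasure lam)
    (hG : ∃ F : ℕ → Finset G, IsFolner F) :
    ∀ φ : Finset G → ℝ,
      (φ = fun E => ∑ S ∈ E.powerset,
          coeff lam E S * Real.log (covNumRel π (coverDyn act U S))) →
      (∀ E : Finset G, E.Nonempty → 0 ≤ φ E) ∧
      (∀ E F : Finset G, E.Nonempty → E ⊆ F → φ E ≤ φ F) ∧
      (∀ (E : Finset G) (g : G), E.Nonempty → φ (E.image fun h => h * g) = φ E) ∧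
      (∀ E F : Finset G, E.Nonempty → F.Nonempty → Disjoint E F →
        φ (E ∪ F) ≤ φ E + φ F) ∧
      ∃ L : ℝ, ∀ F : ℕ → Finset G, IsFolner F →
        Tendsto (fun n => (1 / ((F n).card : ℝ)) * φ (F n)) atTop (nhds L) := by
  intro φ hφ
  set N : Finset G → ℝ := fun S => Real.log (covNumRel π (coverDyn act U S)) with hN
  have hφ' : φ = owPhi lam N := by rw [hφ]; rfl
  have hN0 : ∀ S, 0 ≤ N S := fun S => Real.log_natCast_nonneg _
  have hlog : ∀ a b : ℕ, a ≤ b → Real.log a ≤ Real.log b := by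
    intro a b hab
    rcases Nat.eq_zero_or_pos a with rfl | ha
    · simpa using Real.log_natCast_nonneg b
    · exact Real.log_le_log (by exact_mod_cast ha) (by exact_mod_cast hab)
  have hNm : ∀ S T, S ⊆ T → N S ≤ N T := fun S T h => hlog _ _ (N_mono act π U hUc S T h)
  have hNu : ∀ S T, N (S ∪ T) ≤ N S + N T := by
    intro S T
    have h1 := N_union act π U hUc S T
    have h2 := hlog _ _ h1
    by_cases ha : covNumRel π (coverDyn act U S) = 0
    · rw [ha, zero_mul] at h2
      have := hN0 S
      have := hN0 T
      simp only [Nat.cast_zero, Real.log_zero] at h2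
      exact h2.trans (by linarith)
    by_cases hb : covNumRel π (coverDyn act U T) = 0
    · rw [hb, mul_zero] at h2
      have := hN0 S
      have := hN0 T
      simp only [Nat.cast_zero, Real.log_zero] at h2
      exact h2.trans (by linarith)
    rw [Nat.cast_mul, Real.log_mul (by exact_mod_cast ha) (by exact_mod_cast hb)] at h2
    exact h2
  have hNi : ∀ S (g : G), N (S.image fun h => h * g) = N S := by
    intro S g
    simp only [hN]
    rw [N_inv act π U hUc hactm actY hfac S g]
  have hNe : N ∅ = 0 := by
    refine le_antisymm ?_ (hN0 _)
    simpa using hlog _ _ (N_empty act π U)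
  have h0 : owPhi lam N ∅ = 0 := by simp [owPhi, hNe]
  have hm := owPhi_mono lam hlam N hNm
  have hs := owPhi_sub lam hlam N hNu
  have hi := owPhi_inv lam N hNi
  subst hφ'
  refine ⟨fun E _ => owPhi_nonneg lam hlam N hN0 E, fun E F _ => hm E F, fun E g _ => hi E g,
    fun E F _ _ => hs E F, ow_main (owPhi lam N) h0 hm hi ?_ hG⟩
  intro A B
  rw [← Finset.union_sdiff_self_eq_union]
  exact (hs A (B \ A) Finset.disjoint_sdiff).trans
    (add_le_add_right (hm _ _ Finset.sdiff_subset) _)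
end
end

section
/- Let π : (X,T) → (Y,R) be a factor map between ℤ-systems, μ a T-invariant Borel probability measure on X, and 𝒰 a finite Borel cover of X. With the uniform system of coefficients, Asc_μ^-(T,𝒰|Y) = lim_{n→∞} (1/n) Σ_{0∈S⊆n*} (1/2^{n−1}) H_μ(𝒰_S|Y), where the sum runs over those subsets S of n* that contain 0. -/
open MeasureTheory Filter Set

noncomputable section

open AscLocal


namespace AscLocal

section Aux

variable {X Y : Type*}

lemma exists_coverIt_iff (T : X → X) (U : Finset (Set X)) (S : Finset ℕ) (A : Set X) :
    (∃ B ∈ coverIt T U S, A ⊆ B) ↔ ∀ i ∈ S, ∃ B ∈ U, A ⊆ (T^[i]) ⁻¹' B := by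
  classical
  unfold coverIt
  constructor
  · rintro ⟨B, hB, hAB⟩ i hi
    obtain ⟨f, hf, rfl⟩ := Finset.mem_image.1 hB
    refine ⟨f i hi, Finset.mem_pi.1 hf i hi, fun x hx => ?_⟩
    have := hAB hx
    simp only [Set.mem_iInter] at this
    exact this i hi
  · intro h
    choose f hf hA using h
    refine ⟨_, Finset.mem_image.2 ⟨f, Finset.mem_pi.2 hf, rfl⟩, fun x hx => ?_⟩
    simp only [Set.mem_iInter]
    exact fun i hi => hA i hi hx

lemma refines_coverIt_iff (T : X → X) (U : Finset (Set X)) (S : Finset ℕ) (α : Finset (Set X)) :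
    Refines α (coverIt T U S) ↔ ∀ A ∈ α, ∀ i ∈ S, ∃ B ∈ U, A ⊆ (T^[i]) ⁻¹' B := by
  unfold Refines
  simp only [exists_coverIt_iff]

lemma exists_mpart [MeasurableSpace X] (U : Finset (Set X)) (hUm : ∀ A ∈ U, MeasurableSet A) :
    ∃ α : Finset (Set X), ⋃₀ (α : Set (Set X)) = ⋃₀ (U : Set (Set X)) ∧
      (∀ A ∈ α, MeasurableSet A) ∧ (∀ A ∈ α, ∀ B ∈ α, A ≠ B → Disjoint A B) ∧ Refines α U := by
  classical
  induction U using Finset.induction_on with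
  | empty => exact ⟨∅, rfl, by simp, by simp, by simp [Refines]⟩
  | insert A U hA ih =>
    obtain ⟨α, h1, h2, h3, h4⟩ := ih (fun B hB => hUm B (Finset.mem_insert_of_mem hB))
    have hmU : MeasurableSet (⋃₀ (U : Set (Set X))) :=
      MeasurableSet.sUnion U.finite_toSet.countable
        (fun B hB => hUm B (Finset.mem_insert_of_mem hB))
    have hd : ∀ B ∈ α, Disjoint (A \ ⋃₀ (U : Set (Set X))) B := by
      intro B hB
      have : B ⊆ ⋃₀ (U : Set (Set X)) := by
        rw [← h1]; exact Set.subset_sUnion_of_mem hB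
      exact Set.disjoint_left.2 fun x hx hxB => hx.2 (this hxB)
    refine ⟨insert (A \ ⋃₀ (U : Set (Set X))) α, ?_, ?_, ?_, ?_⟩
    · simp only [Finset.coe_insert, Set.sUnion_insert, h1, Set.sdiff_union_self]
    · intro B hB
      rcases Finset.mem_insert.1 hB with rfl | hB
      · exact (hUm A (Finset.mem_insert_self _ _)).diff hmU
      · exact h2 B hB
    · intro B hB C hC hBC
      rcases Finset.mem_insert.1 hB with rfl | hB <;> rcases Finset.mem_insert.1 hC with rfl | hC
      · exact absurd rfl hBC
      · exact hd C hC
      · exact (hd B hB).symm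
      · exact h3 B hB C hC hBC
    · intro B hB
      rcases Finset.mem_insert.1 hB with rfl | hB
      · exact ⟨A, Finset.mem_insert_self _ _, Set.sdiff_subset⟩
      · obtain ⟨C, hC, h⟩ := h4 B hB
        exact ⟨C, Finset.mem_insert_of_mem hC, h⟩

lemma joinP_mem {α β : Finset (Set X)} {C : Set X} :
    C ∈ joinP α β ↔ ∃ A ∈ α, ∃ B ∈ β, A ∩ B = C := by
  classical
  unfold joinP
  simp only [Finset.mem_image, Finset.mem_product, Prod.exists]
  grind

lemma joinP_part [MeasurableSpace X] {α β : Finset (Set X)} (hα : IsMPartition α)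
    (hβ : IsMPartition β) : IsMPartition (joinP α β) := by
  refine ⟨?_, ?_, ?_⟩
  · refine Set.eq_univ_of_forall fun x => ?_
    have h1 : x ∈ ⋃₀ (α : Set (Set X)) := by rw [hα.1]; trivial
    have h2 : x ∈ ⋃₀ (β : Set (Set X)) := by rw [hβ.1]; trivial
    obtain ⟨A, hA, hx⟩ := h1
    obtain ⟨B, hB, hx'⟩ := h2
    exact ⟨A ∩ B, joinP_mem.2 ⟨A, hA, B, hB, rfl⟩, hx, hx'⟩
  · intro C hC
    obtain ⟨A, hA, B, hB, rfl⟩ := joinP_mem.1 hC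
    exact (hα.2.1 A hA).inter (hβ.2.1 B hB)
  · intro C hC D hD hCD
    obtain ⟨A, hA, B, hB, rfl⟩ := joinP_mem.1 hC
    obtain ⟨A', hA', B', hB', rfl⟩ := joinP_mem.1 hD
    by_cases h : A = A'
    · have h' : B ≠ B' := by rintro rfl; exact hCD (by rw [h])
      exact (hβ.2.2 B hB B' hB' h').mono Set.inter_subset_right Set.inter_subset_right
    · exact (hα.2.2 A hA A' hA' h).mono Set.inter_subset_left Set.inter_subset_left

open Classical in
/-- preimage of a family -/
def preP (f : X → X) (α : Finset (Set X)) : Finset (Set X) := α.image fun A => f ⁻¹' A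

lemma preP_part [MeasurableSpace X] {f : X → X} (hf : Measurable f) {α : Finset (Set X)}
    (hα : IsMPartition α) : IsMPartition (preP f α) := by
  classical
  unfold preP
  refine ⟨?_, ?_, ?_⟩
  · refine Set.eq_univ_of_forall fun x => ?_
    have h1 : f x ∈ ⋃₀ (α : Set (Set X)) := by rw [hα.1]; trivial
    obtain ⟨A, hA, hx⟩ := h1
    exact ⟨f ⁻¹' A, Finset.mem_coe.2 (Finset.mem_image.2 ⟨A, hA, rfl⟩), hx⟩
  · intro C hC
    obtain ⟨A, hA, rfl⟩ := Finset.mem_image.1 hC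
    exact hf (hα.2.1 A hA)
  · intro C hC D hD hCD
    obtain ⟨A, hA, rfl⟩ := Finset.mem_image.1 hC
    obtain ⟨A', hA', rfl⟩ := Finset.mem_image.1 hD
    exact (hα.2.2 A hA A' hA' (by rintro rfl; exact hCD rfl)).preimage f

lemma ent_pointwise {ι κ : Type*} (s : Finset ι) (t : Finset κ) (p : ι → κ → ℝ) (a : ι → ℝ)
    (b : κ → ℝ) (hp : ∀ i ∈ s, ∀ j ∈ t, 0 ≤ p i j) (ha : ∀ i ∈ s, ∑ j ∈ t, p i j = a i)
    (hb : ∀ j ∈ t, ∑ i ∈ s, p i j = b j) (h1 : ∑ i ∈ s, a i = 1) :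
    ∑ i ∈ s, ∑ j ∈ t, Real.negMulLog (p i j) ≤
      ∑ i ∈ s, Real.negMulLog (a i) + ∑ j ∈ t, Real.negMulLog (b j) := by
  have hb1 : ∑ j ∈ t, b j = 1 := by
    rw [← h1, ← Finset.sum_congr rfl hb, ← Finset.sum_congr rfl ha, Finset.sum_comm]
  have key : ∀ i ∈ s, ∀ j ∈ t, Real.negMulLog (p i j) ≤
      (p i j * (-Real.log (a i)) + p i j * (-Real.log (b j))) + (a i * b j - p i j) := by
    intro i hi j hj
    have hai : p i j ≤ a i := by
      rw [← ha i hi]; exact Finset.single_le_sum (f := fun j => p i j) (hp i hi) hj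
    have hbj : p i j ≤ b j := by
      rw [← hb j hj]
      exact Finset.single_le_sum (f := fun i => p i j) (fun i hi => hp i hi j hj) hi
    rcases (hp i hi j hj).eq_or_lt with h | h
    · rw [← h] at hai hbj ⊢
      simp only [Real.negMulLog_zero]
      nlinarith [mul_nonneg hai hbj]
    · have ha0 := h.trans_le hai
      have hb0 := h.trans_le hbj
      have hl := Real.log_le_sub_one_of_pos (x := a i * b j / p i j) (by positivity)
      rw [Real.log_div (by positivity) h.ne', Real.log_mul ha0.ne' hb0.ne'] at hl
      have := mul_le_mul_of_nonneg_left hl h.le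
      have e : p i j * (a i * b j / p i j - 1) = a i * b j - p i j := by field_simp
      rw [e] at this
      unfold Real.negMulLog
      linarith
  calc _ ≤ ∑ i ∈ s, ∑ j ∈ t,
        ((p i j * (-Real.log (a i)) + p i j * (-Real.log (b j))) + (a i * b j - p i j)) :=
        Finset.sum_le_sum fun i hi => Finset.sum_le_sum fun j hj => key i hi j hj
    _ = ∑ i ∈ s, ∑ j ∈ t, p i j * (-Real.log (a i)) + ∑ i ∈ s, ∑ j ∈ t, p i j * (-Real.log (b j))
        + (∑ i ∈ s, ∑ j ∈ t, a i * b j - ∑ i ∈ s, ∑ j ∈ t, p i j) := by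
        simp only [Finset.sum_add_distrib, Finset.sum_sub_distrib]
    _ = _ := by
        have e1 : ∑ i ∈ s, ∑ j ∈ t, p i j * (-Real.log (a i)) = ∑ i ∈ s, Real.negMulLog (a i) := by
          refine Finset.sum_congr rfl fun i hi => ?_
          rw [← Finset.sum_mul, ha i hi, Real.negMulLog]; ring
        have e2 : ∑ i ∈ s, ∑ j ∈ t, p i j * (-Real.log (b j)) = ∑ j ∈ t, Real.negMulLog (b j) := by
          rw [Finset.sum_comm]
          refine Finset.sum_congr rfl fun j hj => ?_
          rw [← Finset.sum_mul, hb j hj, Real.negMulLog]; ring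
        have e3 : ∑ i ∈ s, ∑ j ∈ t, a i * b j = 1 := by
          rw [← Finset.sum_mul_sum, h1, hb1, one_mul]
        have e4 : ∑ i ∈ s, ∑ j ∈ t, p i j = 1 := by rw [Finset.sum_congr rfl ha, h1]
        rw [e1, e2, e3, e4]; ring

variable [m0 : MeasurableSpace X] [mY : MeasurableSpace Y]

/-- term of conditional entropy -/
def cE (μ : Measure X) (pr : X → Y) (A : Set X) : X → ℝ :=
  μ[A.indicator (fun _ => (1 : ℝ)) | MeasurableSpace.comap pr mY]

lemma condEntPart_eq (μ : Measure X) (pr : X → Y) (α : Finset (Set X)) :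
    condEntPart μ pr α = ∑ A ∈ α, ∫ x, Real.negMulLog (cE μ pr A x) ∂μ := rfl

variable (μ : Measure X) [IsProbabilityMeasure μ] {pr : X → Y} (hpr : Measurable pr)

include hpr

lemma int_ind {A : Set X} (hA : MeasurableSet A) :
    Integrable (A.indicator (fun _ => (1 : ℝ))) μ := (integrable_const 1).indicator hA

lemma cE_nonneg (A : Set X) : ∀ᵐ x ∂μ, 0 ≤ cE μ pr A x := by
  have := condExp_nonneg (μ := μ) (m := MeasurableSpace.comap pr mY)
    (f := A.indicator (fun _ => (1 : ℝ)))
    (ae_of_all _ fun x => Set.indicator_nonneg (fun _ _ => zero_le_one) x)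
  exact this

lemma cE_le_one {A : Set X} (hA : MeasurableSet A) : ∀ᵐ x ∂μ, cE μ pr A x ≤ 1 := by
  have := condExp_mono (μ := μ) (m := MeasurableSpace.comap pr mY)
    (f := A.indicator (fun _ => (1 : ℝ))) (g := fun _ => 1)
    (int_ind μ hpr hA) (integrable_const 1)
    (ae_of_all _ fun x => Set.indicator_le_self' (fun _ _ => zero_le_one) x)
  rw [condExp_const hpr.comap_le] at this
  exact this

lemma cE_sum {ι : Type*} (s : Finset ι) (f : ι → Set X) (A : Set X)
    (hf : ∀ i ∈ s, MeasurableSet (f i))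
    (h : ∀ x, A.indicator (fun _ => (1 : ℝ)) x = ∑ i ∈ s, (f i).indicator (fun _ => (1 : ℝ)) x) :
    ∀ᵐ x ∂μ, ∑ i ∈ s, cE μ pr (f i) x = cE μ pr A x := by
  have e : A.indicator (fun _ => (1 : ℝ)) = ∑ i ∈ s, (f i).indicator (fun _ => (1 : ℝ)) := by
    funext x; rw [h x, Finset.sum_apply]
  have := condExp_finsetSum (μ := μ) (s := s) (f := fun i => (f i).indicator (fun _ => (1 : ℝ)))
    (fun i hi => int_ind μ hpr (hf i hi)) (MeasurableSpace.comap pr mY)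
  filter_upwards [this] with x hx
  rw [Finset.sum_apply] at hx
  unfold cE
  rw [e, hx]

lemma negMulLog_cE_int {A : Set X} (hA : MeasurableSet A) :
    Integrable (fun x => Real.negMulLog (cE μ pr A x)) μ := by
  have hm : StronglyMeasurable (cE μ pr A) := stronglyMeasurable_condExp.mono hpr.comap_le
  refine Integrable.of_bound (C := 1)
    (Real.continuous_negMulLog.comp_stronglyMeasurable hm).aestronglyMeasurable ?_
  filter_upwards [cE_nonneg μ hpr A, cE_le_one μ hpr hA] with x h0 h1
  rw [Real.norm_of_nonneg (Real.negMulLog_nonneg h0 h1)]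
  have := Real.one_sub_inv_le_log_of_pos (x := cE μ pr A x)
  rcases h0.eq_or_lt with h | h
  · rw [← h]; simp
  · have := mul_le_mul_of_nonneg_left (this h) h.le
    rw [mul_sub, mul_inv_cancel₀ h.ne'] at this
    unfold Real.negMulLog
    linarith

lemma negMulLog_cE_nonneg {A : Set X} (hA : MeasurableSet A) :
    0 ≤ ∫ x, Real.negMulLog (cE μ pr A x) ∂μ := by
  refine integral_nonneg_of_ae ?_
  filter_upwards [cE_nonneg μ hpr A, cE_le_one μ hpr hA] with x h0 h1
  exact Real.negMulLog_nonneg h0 h1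

lemma condEntPart_nonneg {α : Finset (Set X)} (hα : IsMPartition α) : 0 ≤ condEntPart μ pr α := by
  rw [condEntPart_eq]
  exact Finset.sum_nonneg fun A hA => negMulLog_cE_nonneg μ hpr (hα.2.1 A hA)

omit hpr m0 mY in
lemma sum_ind [MeasurableSpace X] {β : Finset (Set X)} (hβ : IsMPartition β) (A : Set X) (x : X) :
    A.indicator (fun _ => (1 : ℝ)) x = ∑ B ∈ β, (A ∩ B).indicator (fun _ => (1 : ℝ)) x := by
  classical
  have h2 : x ∈ ⋃₀ (β : Set (Set X)) := by rw [hβ.1]; trivial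
  obtain ⟨B, hB, hx⟩ := h2
  rw [Finset.sum_eq_single_of_mem B hB]
  · by_cases h : x ∈ A <;> simp [h, hx]
  · intro C hC hCB
    have : x ∉ C := Set.disjoint_left.1 (hβ.2.2 B hB C hC hCB.symm) hx
    simp [this]

lemma condEntPart_join {α β : Finset (Set X)} (hα : IsMPartition α) (hβ : IsMPartition β) :
    condEntPart μ pr (joinP α β) ≤ condEntPart μ pr α + condEntPart μ pr β := by
  classical
  simp only [condEntPart_eq]
  have hm : ∀ A ∈ α, ∀ B ∈ β, MeasurableSet (A ∩ B) := fun A hA B hB =>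
    (hα.2.1 A hA).inter (hβ.2.1 B hB)
  have s1 : ∑ C ∈ joinP α β, ∫ x, Real.negMulLog (cE μ pr C x) ∂μ ≤
      ∑ A ∈ α, ∑ B ∈ β, ∫ x, Real.negMulLog (cE μ pr (A ∩ B) x) ∂μ := by
    rw [← Finset.sum_product' (f := fun A B => ∫ x, Real.negMulLog (cE μ pr (A ∩ B) x) ∂μ)]
    have hj : joinP α β = (α ×ˢ β).image fun p => p.1 ∩ p.2 := by
      unfold joinP; congr!
    rw [hj]
    refine Finset.sum_image_le_of_nonneg
      (f := fun C => ∫ x, Real.negMulLog (cE μ pr C x) ∂μ) ?_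
    intro C hC
    obtain ⟨p, hp, rfl⟩ := Finset.mem_image.1 hC
    obtain ⟨h1, h2⟩ := Finset.mem_product.1 hp
    exact negMulLog_cE_nonneg μ hpr (hm _ h1 _ h2)
  refine s1.trans ?_
  have e1 : ∑ A ∈ α, ∑ B ∈ β, ∫ x, Real.negMulLog (cE μ pr (A ∩ B) x) ∂μ =
      ∫ x, ∑ A ∈ α, ∑ B ∈ β, Real.negMulLog (cE μ pr (A ∩ B) x) ∂μ := by
    rw [integral_finsetSum]
    · refine Finset.sum_congr rfl fun A hA => ?_
      rw [integral_finsetSum]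
      exact fun B hB => negMulLog_cE_int μ hpr (hm A hA B hB)
    · exact fun A hA => integrable_finsetSum _ fun B hB => negMulLog_cE_int μ hpr (hm A hA B hB)
  have iα : ∀ A ∈ α, Integrable (fun x => Real.negMulLog (cE μ pr A x)) μ :=
    fun A hA => negMulLog_cE_int μ hpr (hα.2.1 A hA)
  have iβ : ∀ A ∈ β, Integrable (fun x => Real.negMulLog (cE μ pr A x)) μ :=
    fun A hA => negMulLog_cE_int μ hpr (hβ.2.1 A hA)
  rw [e1, ← integral_finsetSum _ iα, ← integral_finsetSum _ iβ,
    ← integral_add (integrable_finsetSum _ iα) (integrable_finsetSum _ iβ)]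
  refine integral_mono_ae
    (integrable_finsetSum _ fun A hA => integrable_finsetSum _ fun B hB =>
      negMulLog_cE_int μ hpr (hm A hA B hB))
    ((integrable_finsetSum _ iα).add (integrable_finsetSum _ iβ)) ?_
  have a0 : ∀ᵐ x ∂μ, ∀ A ∈ α, ∀ B ∈ β, 0 ≤ cE μ pr (A ∩ B) x :=
    (Finset.eventually_all _).2 fun A _ => (Finset.eventually_all _).2 fun B _ =>
      cE_nonneg μ hpr _
  have a1 : ∀ᵐ x ∂μ, ∀ A ∈ α, ∑ B ∈ β, cE μ pr (A ∩ B) x = cE μ pr A x :=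
    (Finset.eventually_all _).2 fun A hA =>
      cE_sum μ hpr β (fun B => A ∩ B) A (hm A hA) (sum_ind hβ A)
  have a2 : ∀ᵐ x ∂μ, ∀ B ∈ β, ∑ A ∈ α, cE μ pr (A ∩ B) x = cE μ pr B x :=
    (Finset.eventually_all _).2 fun B hB =>
      cE_sum μ hpr α (fun A => A ∩ B) B (fun A hA => hm A hA B hB) (fun x => by
        rw [sum_ind hα B x]; simp only [Set.inter_comm])
  have a3 : ∀ᵐ x ∂μ, ∑ A ∈ α, cE μ pr A x = cE μ pr Set.univ x :=
      cE_sum μ hpr α (fun A => A) Set.univ hα.2.1 (fun x => by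
        rw [sum_ind hα Set.univ x]; simp only [Set.univ_inter])
  have a4 : cE μ pr Set.univ = fun _ => 1 := by
    unfold cE
    rw [Set.indicator_univ, condExp_const hpr.comap_le]
  filter_upwards [a0, a1, a2, a3] with x h0 h1 h2 h3
  refine ent_pointwise α β (fun A B => cE μ pr (A ∩ B) x) _ _ h0 h1 h2 ?_
  rw [h3, a4]

lemma cE_pre (T : X → X) (hT : MeasurePreserving T μ μ) (R : Y ≃ᵐ Y)
    (hfac : ∀ x : X, pr (T x) = R (pr x)) {A : Set X} (hA : MeasurableSet A) :
    ∀ᵐ x ∂μ, cE μ pr (T ⁻¹' A) x = cE μ pr A (T x) := by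
  have hTm : Measurable[MeasurableSpace.comap pr mY, MeasurableSpace.comap pr mY] T := by
    rintro s ⟨B, hB, rfl⟩
    refine ⟨R ⁻¹' B, R.measurable hB, ?_⟩
    ext x; simp [hfac]
  have hsm : StronglyMeasurable[MeasurableSpace.comap pr mY] (cE μ pr A) :=
    stronglyMeasurable_condExp
  have hint : Integrable (cE μ pr A) μ := integrable_condExp
  have hintT : Integrable (fun x => cE μ pr A (T x)) μ := hT.integrable_comp_of_integrable hint
  have := ae_eq_condExp_of_forall_setIntegral_eq (μ := μ) hpr.comap_le
    (f := (T ⁻¹' A).indicator (fun _ => (1 : ℝ))) (g := fun x => cE μ pr A (T x))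
    (int_ind μ hpr (hT.measurable hA)) (fun s _ _ => hintT.integrableOn) ?_
    (hsm.comp_measurable hTm).aestronglyMeasurable
  · filter_upwards [this] with x hx
    exact hx.symm
  · rintro s ⟨B, hB, rfl⟩ _
    have hs : pr ⁻¹' B = T ⁻¹' (pr ⁻¹' (R.symm ⁻¹' B)) := by
      ext x; simp [hfac]
    have hB' : MeasurableSet (R.symm ⁻¹' B) := R.symm.measurable hB
    have hms : MeasurableSet (pr ⁻¹' (R.symm ⁻¹' B)) := hpr hB'
    rw [hs]
    have e1 : ∀ f : X → ℝ, AEStronglyMeasurable f μ →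
        ∫ x in T ⁻¹' (pr ⁻¹' (R.symm ⁻¹' B)), f (T x) ∂μ = ∫ x in pr ⁻¹' (R.symm ⁻¹' B), f x ∂μ := by
      intro f hf
      have := setIntegral_map (μ := μ) (g := T) (f := f) hms (by rwa [hT.map_eq])
        hT.measurable.aemeasurable
      rw [hT.map_eq] at this
      exact this.symm
    rw [e1 _ hint.aestronglyMeasurable]
    have e2 := e1 (A.indicator fun _ => (1 : ℝ)) (int_ind μ hpr hA).aestronglyMeasurable
    have e3 := setIntegral_condExp (μ := μ) hpr.comap_le (int_ind μ hpr hA)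
      (s := pr ⁻¹' (R.symm ⁻¹' B)) ⟨_, hB', rfl⟩
    exact e3.trans e2.symm

lemma condEntPart_pre (T : X → X) (hT : MeasurePreserving T μ μ) (R : Y ≃ᵐ Y)
    (hfac : ∀ x : X, pr (T x) = R (pr x)) {α : Finset (Set X)} (hα : IsMPartition α) :
    condEntPart μ pr (preP T α) ≤ condEntPart μ pr α := by
  classical
  simp only [condEntPart_eq]
  have hj : preP T α = α.image fun A => T ⁻¹' A := by
    unfold preP; congr!
  rw [hj]
  refine (Finset.sum_image_le_of_nonneg
      (f := fun C => ∫ x, Real.negMulLog (cE μ pr C x) ∂μ) ?_).trans ?_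
  · intro C hC
    obtain ⟨A, hA, rfl⟩ := Finset.mem_image.1 hC
    exact negMulLog_cE_nonneg μ hpr (hT.measurable (hα.2.1 A hA))
  · refine Finset.sum_le_sum fun A hA => le_of_eq ?_
    have := cE_pre μ hpr T hT R hfac (hα.2.1 A hA)
    rw [integral_congr_ae (g := fun x => Real.negMulLog (cE μ pr A (T x)))
      (by filter_upwards [this] with x hx; rw [hx])]
    have h2 := integral_map (μ := μ) (φ := T) hT.measurable.aemeasurable
      (f := fun x => Real.negMulLog (cE μ pr A x))
      (by rw [hT.map_eq]; exact (negMulLog_cE_int μ hpr (hα.2.1 A hA)).aestronglyMeasurable)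
    rw [hT.map_eq] at h2
    exact h2.symm

lemma condEntCover_le {α V : Finset (Set X)} (hα : IsMPartition α) (h : Refines α V) :
    condEntCover μ pr V ≤ condEntPart μ pr α :=
  csInf_le ⟨0, by rintro _ ⟨β, hβ, _, rfl⟩; exact condEntPart_nonneg μ hpr hβ⟩ ⟨α, hα, h, rfl⟩

lemma condEntCover_nonneg (V : Finset (Set X)) : 0 ≤ condEntCover μ pr V :=
  Real.sInf_nonneg (by rintro _ ⟨β, hβ, _, rfl⟩; exact condEntPart_nonneg μ hpr hβ)

omit hpr [IsProbabilityMeasure μ] in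
lemma le_condEntCover {V : Finset (Set X)} (hne : ∃ α, IsMPartition (X := X) α ∧ Refines α V)
    {c : ℝ} (h : ∀ α, IsMPartition α → Refines α V → c ≤ condEntPart μ pr α) :
    c ≤ condEntCover μ pr V := by
  obtain ⟨α, h1, h2⟩ := hne
  refine le_csInf ⟨_, α, h1, h2, rfl⟩ ?_
  rintro _ ⟨β, hβ, hr, rfl⟩
  exact h β hβ hr

omit hpr mY in
lemma exists_ref (T : X → X) (hT : Measurable T) (U : Finset (Set X)) (hUc : IsCover U)
    (hUm : ∀ A ∈ U, MeasurableSet A) (S : Finset ℕ) :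
    ∃ α, IsMPartition (X := X) α ∧ Refines α (coverIt T U S) := by
  classical
  obtain ⟨β, h1, h2, h3, h4⟩ := exists_mpart U hUm
  have hβ : IsMPartition β := ⟨h1.trans hUc, h2, h3⟩
  induction S using Finset.induction_on with
  | empty =>
    exact ⟨β, hβ, by rw [refines_coverIt_iff]; simp⟩
  | insert i S hi ih =>
    obtain ⟨α, hα, hr⟩ := ih
    rw [refines_coverIt_iff] at hr
    refine ⟨joinP α (preP T^[i] β), joinP_part hα (preP_part (hT.iterate i) hβ), ?_⟩
    rw [refines_coverIt_iff]
    intro C hC j hj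
    obtain ⟨A, hA, B, hB, rfl⟩ := joinP_mem.1 hC
    rcases Finset.mem_insert.1 hj with rfl | hj
    · unfold preP at hB
      obtain ⟨D, hD, rfl⟩ := Finset.mem_image.1 hB
      obtain ⟨E, hE, hDE⟩ := h4 D hD
      exact ⟨E, hE, fun x hx => hDE hx.2⟩
    · obtain ⟨E, hE, hAE⟩ := hr A hA j hj
      exact ⟨E, hE, fun x hx => hAE hx.1⟩

lemma h_mono (T : X → X) (hT : Measurable T) (U : Finset (Set X)) (hUc : IsCover U)
    (hUm : ∀ A ∈ U, MeasurableSet A) {S S' : Finset ℕ} (h : S ⊆ S') :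
    condEntCover μ pr (coverIt T U S) ≤ condEntCover μ pr (coverIt T U S') := by
  refine le_condEntCover μ (exists_ref T hT U hUc hUm S') fun α hα hr =>
    condEntCover_le μ hpr hα ?_
  rw [refines_coverIt_iff] at hr ⊢
  exact fun A hA i hi => hr A hA i (h hi)

lemma h_union (T : X → X) (hT : Measurable T) (U : Finset (Set X)) (hUc : IsCover U)
    (hUm : ∀ A ∈ U, MeasurableSet A) (S S' : Finset ℕ) :
    condEntCover μ pr (coverIt T U (S ∪ S')) ≤
      condEntCover μ pr (coverIt T U S) + condEntCover μ pr (coverIt T U S') := by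
  rw [← sub_le_iff_le_add]
  refine le_condEntCover μ (exists_ref T hT U hUc hUm S) fun α hα hr => ?_
  rw [sub_le_iff_le_add, ← sub_le_iff_le_add']
  refine le_condEntCover μ (exists_ref T hT U hUc hUm S') fun β hβ hr' => ?_
  rw [sub_le_iff_le_add']
  refine le_trans ?_ (condEntPart_join μ hpr hα hβ)
  refine condEntCover_le μ hpr (joinP_part hα hβ) ?_
  rw [refines_coverIt_iff] at hr hr' ⊢
  intro C hC j hj
  obtain ⟨A, hA, B, hB, rfl⟩ := joinP_mem.1 hC
  rcases Finset.mem_union.1 hj with hj | hj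
  · obtain ⟨E, hE, hAE⟩ := hr A hA j hj
    exact ⟨E, hE, fun x hx => hAE hx.1⟩
  · obtain ⟨E, hE, hAE⟩ := hr' B hB j hj
    exact ⟨E, hE, fun x hx => hAE hx.2⟩

lemma h_shift1 (T : X → X) (hT : MeasurePreserving T μ μ) (R : Y ≃ᵐ Y)
    (hfac : ∀ x : X, pr (T x) = R (pr x)) (U : Finset (Set X)) (hUc : IsCover U)
    (hUm : ∀ A ∈ U, MeasurableSet A) (S : Finset ℕ) :
    condEntCover μ pr (coverIt T U (S.image (· + 1))) ≤ condEntCover μ pr (coverIt T U S) := by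
  classical
  refine le_condEntCover μ (exists_ref T hT.measurable U hUc hUm S) fun α hα hr => ?_
  refine le_trans ?_ (condEntPart_pre μ hpr T hT R hfac hα)
  refine condEntCover_le μ hpr (preP_part hT.measurable hα) ?_
  rw [refines_coverIt_iff] at hr ⊢
  intro C hC j hj
  unfold preP at hC
  obtain ⟨D, hD, rfl⟩ := Finset.mem_image.1 hC
  obtain ⟨i, hi, rfl⟩ := Finset.mem_image.1 hj
  obtain ⟨E, hE, hDE⟩ := hr D hD i hi
  refine ⟨E, hE, fun x hx => ?_⟩
  have := hDE hx
  simpa [Function.iterate_succ_apply] using this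

lemma h_shift (T : X → X) (hT : MeasurePreserving T μ μ) (R : Y ≃ᵐ Y)
    (hfac : ∀ x : X, pr (T x) = R (pr x)) (U : Finset (Set X)) (hUc : IsCover U)
    (hUm : ∀ A ∈ U, MeasurableSet A) (S : Finset ℕ) (n : ℕ) :
    condEntCover μ pr (coverIt T U (S.image (· + n))) ≤ condEntCover μ pr (coverIt T U S) := by
  induction n with
  | zero => simp
  | succ n ih =>
    refine le_trans ?_ ((h_shift1 μ hpr T hT R hfac U hUc hUm (S.image (· + n))).trans ih)
    rw [Finset.image_image]
    exact le_of_eq rfl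

end Aux

lemma sum_split (h : Finset ℕ → ℝ) (n m : ℕ) :
    ∑ S ∈ (Finset.range (n + m)).powerset, h S =
      ∑ S ∈ (Finset.range n).powerset, ∑ S' ∈ (Finset.range m).powerset,
        h (S ∪ S'.image (· + n)) := by
  rw [← Finset.sum_product' (f := fun (S S' : Finset ℕ) => h (S ∪ S'.image (· + n)))]
  symm
  refine Finset.sum_nbij' (fun p => p.1 ∪ p.2.image (· + n))
    (fun S => (S.filter (· < n), (S.filter (n ≤ ·)).image (· - n))) ?_ ?_ ?_ ?_ ?_
  · rintro ⟨S, S'⟩ hp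
    simp only [Finset.mem_product, Finset.mem_powerset] at hp ⊢
    intro i hi
    rcases Finset.mem_union.1 hi with hi | hi
    · have := Finset.mem_range.1 (hp.1 hi)
      exact Finset.mem_range.2 (by omega)
    · obtain ⟨j, hj, rfl⟩ := Finset.mem_image.1 hi
      have := Finset.mem_range.1 (hp.2 hj)
      exact Finset.mem_range.2 (by omega)
  · intro S hS
    simp only [Finset.mem_product, Finset.mem_powerset] at hS ⊢
    constructor
    · intro i hi
      exact Finset.mem_range.2 (Finset.mem_filter.1 hi).2
    · intro i hi
      obtain ⟨j, hj, rfl⟩ := Finset.mem_image.1 hi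
      have h1 := Finset.mem_range.1 (hS (Finset.mem_filter.1 hj).1)
      have h2 := (Finset.mem_filter.1 hj).2
      exact Finset.mem_range.2 (by omega)
  · rintro ⟨S, S'⟩ hp
    simp only [Finset.mem_product, Finset.mem_powerset] at hp
    have hS : ∀ i ∈ S, i < n := fun i hi => Finset.mem_range.1 (hp.1 hi)
    refine Prod.ext ?_ ?_
    · ext i
      simp only [Finset.mem_filter, Finset.mem_union, Finset.mem_image]
      constructor
      · rintro ⟨h | ⟨j, hj, rfl⟩, h'⟩
        · exact h
        · omega
      · exact fun h => ⟨Or.inl h, hS i h⟩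
    · ext i
      simp only [Finset.mem_filter, Finset.mem_union, Finset.mem_image]
      constructor
      · rintro ⟨k, ⟨h | ⟨j, hj, rfl⟩, h'⟩, rfl⟩
        · have := hS k h
          omega
        · simpa using hj
      · exact fun h => ⟨i + n, ⟨Or.inr ⟨i, h, rfl⟩, by omega⟩, by omega⟩
  · intro S hS
    ext i
    simp only [Finset.mem_filter, Finset.mem_union, Finset.mem_image]
    constructor
    · rintro (h | ⟨k, ⟨j, ⟨hj, hj'⟩, rfl⟩, rfl⟩)
      · exact h.1
      · rwa [Nat.sub_add_cancel hj']
    · intro h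
      rcases lt_or_ge i n with h' | h'
      · exact Or.inl ⟨h, h'⟩
      · exact Or.inr ⟨i - n, ⟨i, ⟨h, h'⟩, rfl⟩, by omega⟩
  · intro p _; rfl

lemma main_abs (h : Finset ℕ → ℝ) (h0 : ∀ S, 0 ≤ h S) (hmono : ∀ S S', S ⊆ S' → h S ≤ h S')
    (hun : ∀ S S', h (S ∪ S') ≤ h S + h S') (hsh : ∀ S n, h (S.image (· + n)) ≤ h S) :
    Tendsto (fun n : ℕ => (1 / (n : ℝ)) *
        ∑ S ∈ (Finset.range n).powerset.filter (fun S => 0 ∈ S), ((1 : ℝ) / 2) ^ (n - 1) * h S)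
      atTop (nhds (limSeq fun n => (1 / (n : ℝ)) * ∑ S ∈ (Finset.range n).powerset,
        ((1 : ℝ) / 2) ^ n * h S)) := by
  set a : ℕ → ℝ := fun n => ∑ S ∈ (Finset.range n).powerset, ((1 : ℝ) / 2) ^ n * h S with ha
  have ha0 : ∀ n, 0 ≤ a n := fun n => Finset.sum_nonneg fun S _ => by
    have := h0 S
    positivity
  have hsub : Subadditive a := by
    intro n m
    simp only [ha, ← Finset.mul_sum]
    rw [sum_split]
    have : ∑ S ∈ (Finset.range n).powerset, ∑ S' ∈ (Finset.range m).powerset,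
        h (S ∪ S'.image (· + n)) ≤ ∑ S ∈ (Finset.range n).powerset,
          ∑ S' ∈ (Finset.range m).powerset, (h S + h S') :=
      Finset.sum_le_sum fun S _ => Finset.sum_le_sum fun S' _ =>
        (hun _ _).trans (by linarith [hsh S' n])
    refine (mul_le_mul_of_nonneg_left this (by positivity)).trans (le_of_eq ?_)
    simp only [Finset.sum_add_distrib, Finset.sum_const, Finset.card_powerset, Finset.card_range,
      nsmul_eq_mul, ← Finset.mul_sum, pow_add, one_div, inv_pow]
    push_cast
    field_simp
  have hbdd : BddBelow (Set.range fun n => a n / n) :=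
    ⟨0, by rintro _ ⟨n, rfl⟩; exact div_nonneg (ha0 n) (Nat.cast_nonneg n)⟩
  have hlim := hsub.tendsto_lim hbdd
  have hlim' : Tendsto (fun n : ℕ => (1 / (n : ℝ)) * a n) atTop (nhds hsub.lim) := by
    refine hlim.congr fun n => ?_
    ring
  have heq : limSeq (fun n : ℕ => (1 / (n : ℝ)) * a n) = hsub.lim := hlim'.limUnder_eq
  rw [heq]
  have hC : Tendsto (fun n : ℕ => (1 / (n : ℝ)) * a n + (1 / (n : ℝ)) * h {0}) atTop
      (nhds hsub.lim) := by
    have := hlim'.add ((tendsto_one_div_atTop_nhds_zero_nat (𝕜 := ℝ)).mul_const (h {0}))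
    simpa using this
  have key : ∀ n : ℕ, 1 ≤ n →
      a n ≤ ∑ S ∈ (Finset.range n).powerset.filter (fun S => 0 ∈ S), ((1 : ℝ) / 2) ^ (n - 1) * h S ∧
      ∑ S ∈ (Finset.range n).powerset.filter (fun S => 0 ∈ S), ((1 : ℝ) / 2) ^ (n - 1) * h S
        ≤ a n + h {0} := by
    intro n hn
    obtain ⟨k, rfl⟩ : ∃ k, n = k + 1 := ⟨n - 1, by omega⟩
    have hr : Finset.range (k + 1) = insert 0 (Finset.Ico 1 (k + 1)) := by
      ext i; simp only [Finset.mem_range, Finset.mem_insert, Finset.mem_Ico]; omega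
    have hnot : 0 ∉ Finset.Ico 1 (k + 1) := by simp
    have hnS : ∀ S ∈ (Finset.Ico 1 (k + 1)).powerset, 0 ∉ S := fun S hS h =>
      hnot (Finset.mem_powerset.1 hS h)
    simp only [ha, ← Finset.mul_sum, Nat.add_sub_cancel]
    rw [Finset.sum_filter, hr, Finset.sum_powerset_insert hnot, Finset.sum_powerset_insert hnot]
    rw [Finset.sum_congr (g := fun _ => (0 : ℝ)) rfl (fun S hS => if_neg (hnS S hS))]
    simp only [Finset.sum_const_zero, zero_add, Finset.mem_insert_self, if_true]
    set P := ∑ S ∈ (Finset.Ico 1 (k + 1)).powerset, h S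
    set Q := ∑ S ∈ (Finset.Ico 1 (k + 1)).powerset, h (insert 0 S)
    have h1 : P ≤ Q := Finset.sum_le_sum fun S _ => hmono _ _ (Finset.subset_insert _ _)
    have h2 : Q ≤ P + 2 ^ k * h {0} := by
      have : Q ≤ ∑ S ∈ (Finset.Ico 1 (k + 1)).powerset, (h S + h {0}) :=
        Finset.sum_le_sum fun S _ => by
          have := hun S {0}
          rwa [Finset.union_comm, ← Finset.insert_eq] at this
      simpa [Finset.sum_add_distrib] using this
    have hp : (0 : ℝ) < (1 / 2) ^ k := by positivity
    have hpk : ((1 : ℝ) / 2) ^ k * 2 ^ k = 1 := by rw [← mul_pow]; norm_num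
    rw [pow_succ]
    constructor
    · nlinarith
    · have h3 := mul_le_mul_of_nonneg_left h2 hp.le
      rw [mul_add, ← mul_assoc, hpk] at h3
      nlinarith [h0 {0}]
  refine tendsto_of_tendsto_of_tendsto_of_le_of_le' hlim' hC ?_ ?_
  · filter_upwards [eventually_ge_atTop 1] with n hn
    exact mul_le_mul_of_nonneg_left (key n hn).1 (by positivity)
  · filter_upwards [eventually_ge_atTop 1] with n hn
    rw [← mul_add]
    exact mul_le_mul_of_nonneg_left (key n hn).2 (by positivity)

end AscLocal

theorem statement2 {X Y : Type*}
    [MetricSpace X] [CompactSpace X] [MeasurableSpace X] [BorelSpace X]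
    [MetricSpace Y] [CompactSpace Y] [MeasurableSpace Y] [BorelSpace Y]
    (T : X ≃ₜ X) (R : Y ≃ₜ Y)
    (π : X → Y) (hπc : Continuous π) (hπs : Function.Surjective π)
    (hfac : ∀ x : X, π (T x) = R (π x))
    (μ : Measure X) (hμ : IsProbabilityMeasure μ) (hinv : Measure.map (⇑T) μ = μ)
    (U : Finset (Set X)) (hUc : IsCover U) (hUm : ∀ A ∈ U, MeasurableSet A) :
    Tendsto (fun n : ℕ => (1 / (n : ℝ)) *
        ∑ S ∈ (Finset.range n).powerset.filter (fun S => 0 ∈ S),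
          ((1 : ℝ) / 2) ^ (n - 1) * condEntCover μ π (coverIt (⇑T) U S))
      atTop (nhds (zAscCondMinus μ π (⇑T) U)) := by
  have hμ' := hμ
  have hT : MeasurePreserving (⇑T) μ μ := ⟨T.continuous.measurable, hinv⟩
  have hpr : Measurable π := hπc.measurable
  exact main_abs (fun S => condEntCover μ π (coverIt (⇑T) U S))
    (fun S => condEntCover_nonneg μ hpr _)
    (fun S S' h => h_mono μ hpr (⇑T) hT.measurable U hUc hUm h)
    (fun S S' => h_union μ hpr (⇑T) hT.measurable U hUc hUm S S')
    (fun S n => h_shift μ hpr (⇑T) hT R.toMeasurableEquiv hfac U hUc hUm S n)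
end
end
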